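/- arXiv:0808.3225 — 3 statements merged into one kernel-verified Lean document; each statement's English description precedes it below -/
import Mathlib

section
/- Let (X_i)_{i∈ι} be a family of locally compact topological spaces, and for each i let Y_i ⊆ X_i be a compact open subset. Let X = Πʳ_i [X_i, Y_i] be the restricted topological product, consisting of all x ∈ Π_i X_i with x_i ∈ Y_i for all but finitely many i, with its restricted product topology. Let ρ_i : X_i → ℝ be continuous functions such that, for all but finitely many i, ρ_i vanishes identically on Y_i. Then for each x ∈ X only finitely many of the values ρ_i(x_i) are nonzero, and the function ρ : X → ℝ defined by ρ(x) = Σ_i ρ_i(x_i) (a finite sum, e.g. finsum) is continuous on X. -/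
/-! **Statement 4** (Lemma 5.1 of the paper). Continuity of a sum of local
functions on a restricted topological product. -/

variable {ι : Type*}

/-- The restricted product `Πʳ_i [X i, Y i]`: all `x ∈ Π i, X i` with
`x i ∈ Y i` for all but finitely many `i`. -/
def RestrictedProd (X : ι → Type*) (Y : ∀ i, Set (X i)) : Type _ :=
  {x : ∀ i, X i // ∀ᶠ i in Filter.cofinite, x i ∈ Y i}

/-- For a finite set `S` of indices, the "partial product" `X(S)`, that is
`Π_{i ∈ S} X i × Π_{i ∉ S} Y i`, realized as a subspace of the full direct
product with its product topology. -/
def partialProd (X : ι → Type*) (Y : ∀ i, Set (X i)) (S : Finset ι) : Type _ :=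
  {x : ∀ i, X i // ∀ i ∉ S, x i ∈ Y i}

instance partialProd.topologicalSpace (X : ι → Type*) [∀ i, TopologicalSpace (X i)]
    (Y : ∀ i, Set (X i)) (S : Finset ι) : TopologicalSpace (partialProd X Y S) :=
  instTopologicalSpaceSubtype

/-- The inclusion `X(S) → Πʳ_i [X i, Y i]`. -/
def partialProd.incl (X : ι → Type*) (Y : ∀ i, Set (X i)) (S : Finset ι)
    (x : partialProd X Y S) : RestrictedProd X Y :=
  ⟨x.1, Filter.eventually_cofinite.2 <| Set.Finite.subset S.finite_toSet
    (fun i hi => by by_contra h; exact hi (x.2 i h))⟩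

/-- The restricted product topology: a set `U` is open iff its preimage in each
`X(S)` is open, i.e. the final topology with respect to the inclusions of the
partial products `X(S)`. -/
instance RestrictedProd.topologicalSpace (X : ι → Type*) [∀ i, TopologicalSpace (X i)]
    (Y : ∀ i, Set (X i)) : TopologicalSpace (RestrictedProd X Y) :=
  ⨆ S : Finset ι, TopologicalSpace.coinduced (partialProd.incl X Y S) inferInstance

theorem RestrictedProd.continuous_dom {X : ι → Type*} [∀ i, TopologicalSpace (X i)]
    {Y : ∀ i, Set (X i)} {Z : Type*} [TopologicalSpace Z] {f : RestrictedProd X Y → Z} :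
    Continuous f ↔ ∀ S : Finset ι, Continuous (f ∘ partialProd.incl X Y S) := by
  simp only [continuous_iSup_dom, continuous_coinduced_dom]

theorem partialProd.continuous_eval {X : ι → Type*} [∀ i, TopologicalSpace (X i)]
    {Y : ∀ i, Set (X i)} {S : Finset ι} (i : ι) :
    Continuous fun x : partialProd X Y S => x.1 i :=
  (continuous_apply i).comp continuous_subtype_val

theorem RestrictedProd.finite_apply_ne_zero {X : ι → Type*} {Y : ∀ i, Set (X i)}
    {M : Type*} [Zero M] {ρ : ∀ i, X i → M}
    (hvan : ∀ᶠ i in Filter.cofinite, ∀ y ∈ Y i, ρ i y = 0) (x : RestrictedProd X Y) :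
    {i | ρ i (x.1 i) ≠ 0}.Finite :=
  Filter.eventually_cofinite.1 <| by
    filter_upwards [hvan, x.2] with i hi hx using hi _ hx

theorem RestrictedProd.continuous_finsum {X : ι → Type*} [∀ i, TopologicalSpace (X i)]
    {Y : ∀ i, Set (X i)} {M : Type*} [AddCommMonoid M] [TopologicalSpace M] [ContinuousAdd M]
    {ρ : ∀ i, X i → M} (hρ : ∀ i, Continuous (ρ i))
    (hvan : ∀ᶠ i in Filter.cofinite, ∀ y ∈ Y i, ρ i y = 0) :
    Continuous fun x : RestrictedProd X Y => ∑ᶠ i, ρ i (x.1 i) := by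
  classical
  refine RestrictedProd.continuous_dom.2 fun S => ?_
  have hT := Filter.eventually_cofinite.1 hvan
  have hsum : ((fun x : RestrictedProd X Y => ∑ᶠ i, ρ i (x.1 i)) ∘ partialProd.incl X Y S) =
      fun x => ∑ i ∈ S ∪ hT.toFinset, ρ i (x.1 i) := by
    funext x
    refine finsum_eq_sum_of_support_subset _ fun i hi => ?_
    by_contra hmem
    simp only [Finset.coe_union, Set.Finite.coe_toFinset, Set.mem_union, Finset.mem_coe,
      Set.mem_ofPred_eq, not_or, not_not] at hmem
    exact hi (hmem.2 _ (x.2 i hmem.1))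
  rw [hsum]
  exact continuous_finsetSum _ fun i _ => (hρ i).comp (partialProd.continuous_eval i)

/-- If each `X i` is locally compact, each `Y i ⊆ X i` is compact open, and
`ρ i : X i → ℝ` are continuous functions vanishing on `Y i` for all but finitely
many `i`, then on the restricted product `Πʳ_i [X i, Y i]` only finitely many of
the `ρ i (x i)` are nonzero and `x ↦ Σ_i ρ i (x i)` is continuous. -/
theorem restrictedProd_finsum_continuous
    (X : ι → Type*) [∀ i, TopologicalSpace (X i)] [∀ i, LocallyCompactSpace (X i)]
    (Y : ∀ i, Set (X i)) (hYc : ∀ i, IsCompact (Y i)) (hYo : ∀ i, IsOpen (Y i))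
    (ρ : ∀ i, X i → ℝ) (hρ : ∀ i, Continuous (ρ i))
    (hvan : ∀ᶠ i in Filter.cofinite, ∀ y ∈ Y i, ρ i y = 0) :
    (∀ x : RestrictedProd X Y, {i | ρ i (x.1 i) ≠ 0}.Finite) ∧
    Continuous (fun x : RestrictedProd X Y => ∑ᶠ i, ρ i (x.1 i)) := by
  exact ⟨RestrictedProd.finite_apply_ne_zero hvan, RestrictedProd.continuous_finsum hρ hvan⟩
end

section
/- Let K be a number field, regarded as a subfield of ℂ, let n be a natural number, and let G be a subgroup of GL_n(ℂ) which is the set of all g ∈ GL_n(ℂ) satisfying p(entries of g) = 0 for every p in some set P of polynomials in the n² matrix-entry variables with coefficients in K (so G is a Zariski-closed subgroup of GL_n(ℂ) defined over K). Then there exists a finite field extension L of K with L ⊆ ℂ such that G ∩ GL_n(L) is Zariski dense in G; that is, every polynomial q in the n² matrix-entry variables with complex coefficients that vanishes at every element of G ∩ GL_n(L) vanishes at every element of G. -/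
open TopologicalSpace

section NoetherianGroup

variable {Γ : Type*} [Group Γ] [TopologicalSpace Γ] [SeparatelyContinuousMul Γ]

/-- In a Noetherian semitopological group, the closure of a subgroup is a subgroup. -/
theorem exists_subgroup_coe_eq_closure [NoetherianSpace Γ] (H : Subgroup Γ) :
    ∃ H' : Subgroup Γ, (H' : Set Γ) = closure (H : Set Γ) := by
  set M := H.toSubmonoid.topologicalClosure with hM
  have hcl : IsClosed (M : Set Γ) := H.toSubmonoid.isClosed_topologicalClosure
  refine ⟨{ M with inv_mem' := ?_ }, rfl⟩
  intro g hg
  change g⁻¹ ∈ M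
  have hgM : g ∈ M := hg
  let C : ℕ → Closeds Γ := fun j =>
    ⟨(fun x => g ^ j * x) '' (M : Set Γ), (Homeomorph.mulLeft (g ^ j)).isClosedMap _ hcl⟩
  have hanti : Antitone C := by
    refine antitone_nat_of_succ_le fun j => ?_
    rintro _ ⟨x, hx, rfl⟩
    exact ⟨g * x, mul_mem hgM hx, by simp [pow_succ, mul_assoc]⟩
  obtain ⟨N, hN⟩ := WellFoundedGT.monotone_chain_condition (α := (Closeds Γ)ᵒᵈ) ⟨C, hanti⟩
  have h1 : g ^ N ∈ C (N + 1) := by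
    rw [← show C N = C (N + 1) from hN (N + 1) (Nat.le_succ N)]
    exact ⟨1, one_mem M, mul_one _⟩
  obtain ⟨x, hx, hxe⟩ := h1
  have : x = g⁻¹ := by
    have : g ^ N * (g * x) = g ^ N * 1 := by simpa [pow_succ, mul_assoc] using hxe
    exact eq_inv_of_mul_eq_one_right (mul_left_cancel this)
  exact this ▸ hx

/-- An irreducible set through the identity lies in every closed subgroup of finite index. -/
theorem IsIrreducible.subset_of_finiteIndex {T : Set Γ} (hT : IsIrreducible T)
    (h1 : (1 : Γ) ∈ T) (S : Subgroup Γ) [S.FiniteIndex] (hS : IsClosed (S : Set Γ)) :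
    T ⊆ S := by
  classical
  have := Fintype.ofFinite (Γ ⧸ S)
  obtain ⟨Z, hZ, hTZ⟩ := (isIrreducible_iff_sUnion_isClosed.1 hT)
    (Finset.univ.image fun q : Γ ⧸ S => (fun x => q.out * x) '' (S : Set Γ))
    (by
      intro Z hZ
      obtain ⟨q, -, rfl⟩ := Finset.mem_image.1 hZ
      exact (Homeomorph.mulLeft q.out).isClosedMap _ hS)
    (by
      intro x _
      refine Set.mem_sUnion.2 ⟨_, Finset.mem_coe.2 (Finset.mem_image_of_mem _
        (Finset.mem_univ (x : Γ ⧸ S))), (x : Γ ⧸ S).out⁻¹ * x, ?_, by simp⟩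
      exact QuotientGroup.eq.1 (Quotient.out_eq' (x : Γ ⧸ S)))
  obtain ⟨q, -, rfl⟩ := Finset.mem_image.1 hZ
  obtain ⟨s, hs, hqs⟩ := hTZ h1
  have hq : q.out ∈ S := by
    rw [eq_inv_of_mul_eq_one_left hqs]; exact S.inv_mem hs
  rintro x hx
  obtain ⟨y, hy, rfl⟩ := hTZ hx
  exact S.mul_mem hq hy

/-- A homeomorphism maps irreducible components to irreducible components. -/
theorem Homeomorph.image_mem_irreducibleComponents {X Y : Type*} [TopologicalSpace X]
    [TopologicalSpace Y] (e : X ≃ₜ Y) {Z : Set X} (hZ : Z ∈ irreducibleComponents X) :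
    e '' Z ∈ irreducibleComponents Y := by
  refine ⟨hZ.1.image e e.continuous.continuousOn, fun W hW hle => ?_⟩
  have h := hZ.2 (hW.image e.symm e.symm.continuous.continuousOn) (by
    intro z hz
    exact ⟨e z, hle ⟨z, hz, rfl⟩, by simp⟩)
  intro w hw
  exact ⟨e.symm w, h ⟨w, hw, rfl⟩, by simp⟩

variable (Γ) in
/-- A Noetherian semitopological group has a closed irreducible subgroup of finite index. -/
theorem exists_isIrreducible_finiteIndex [NoetherianSpace Γ] :
    ∃ S : Subgroup Γ, S.FiniteIndex ∧ IsClosed (S : Set Γ) ∧ IsIrreducible (S : Set Γ) := by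
  let act : MulAction Γ (irreducibleComponents Γ) :=
    { smul := fun g Z => ⟨(fun x => g * x) '' Z.1,
        (Homeomorph.mulLeft g).image_mem_irreducibleComponents Z.2⟩
      one_smul := fun Z => Subtype.ext (by
        change (fun x => 1 * x) '' Z.1 = Z.1
        simp)
      mul_smul := fun g h Z => Subtype.ext (by
        change (fun x => g * h * x) '' Z.1 = (fun x => g * x) '' ((fun x => h * x) '' Z.1)
        rw [Set.image_image]
        simp only [mul_assoc]) }
  have hfin : Finite (irreducibleComponents Γ) :=
    (NoetherianSpace.finite_irreducibleComponents (α := Γ)).to_subtype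
  set S := (MulAction.toPermHom Γ (irreducibleComponents Γ)).ker with hSdef
  have hmem : ∀ g, g ∈ S ↔ ∀ Z ∈ irreducibleComponents Γ, ∀ z ∈ Z, g * z ∈ Z := by
    intro g
    rw [hSdef, MonoidHom.mem_ker, Equiv.Perm.ext_iff]
    constructor
    · intro h Z hZ z hz
      have h2 : (fun x => g * x) '' Z = Z := congrArg Subtype.val (h ⟨Z, hZ⟩)
      rw [← h2]
      exact ⟨z, hz, rfl⟩
    · rintro h ⟨Z, hZ⟩
      refine Subtype.ext ?_
      change (fun x => g * x) '' Z = Z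
      have hi := (Homeomorph.mulLeft g).image_mem_irreducibleComponents hZ
      have hsub : (fun x => g * x) '' Z ⊆ Z := by
        rintro _ ⟨z, hz, rfl⟩
        exact h Z hZ z hz
      exact hsub.antisymm (hi.2 hZ.1 hsub)
  have hclosed : IsClosed (S : Set Γ) := by
    have : (S : Set Γ) = ⋂ Z ∈ irreducibleComponents Γ, ⋂ z ∈ Z, (fun g => g * z) ⁻¹' Z := by
      ext g
      simp only [SetLike.mem_coe, hmem, Set.mem_iInter, Set.mem_preimage]
    rw [this]
    exact isClosed_biInter fun Z hZ => isClosed_biInter fun z _ =>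
      (isClosed_of_mem_irreducibleComponents Z hZ).preimage (Homeomorph.mulRight z).continuous
  have hfi : S.FiniteIndex := Subgroup.finiteIndex_ker _
  refine ⟨S, hfi, hclosed, ?_⟩
  have hZ := irreducibleComponent_mem_irreducibleComponents (1 : Γ)
  have h1 : (1 : Γ) ∈ irreducibleComponent (1 : Γ) := mem_irreducibleComponent
  have hle := isIrreducible_irreducibleComponent.subset_of_finiteIndex h1 S hclosed
  have : (S : Set Γ) = irreducibleComponent (1 : Γ) := by
    refine Set.Subset.antisymm (fun s hs => ?_) hle
    simpa using (hmem s).1 hs _ hZ 1 h1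
  rw [this]
  exact isIrreducible_irreducibleComponent

end NoetherianGroup

section RelativeFiniteIndex

variable {Γ : Type*} [Group Γ] [TopologicalSpace Γ] [SeparatelyContinuousMul Γ]

instance Subgroup.separatelyContinuousMul (H : Subgroup Γ) : SeparatelyContinuousMul H where
  continuous_const_mul := ((continuous_const_mul _).comp continuous_subtype_val).subtype_mk _
  continuous_mul_const := ((continuous_mul_const _).comp continuous_subtype_val).subtype_mk _

theorem IsIrreducible.subset_of_isFiniteRelIndex {T : Set Γ} (hT : IsIrreducible T)
    (h1 : (1 : Γ) ∈ T) {S H : Subgroup Γ} (hTH : T ⊆ H) [S.IsFiniteRelIndex H]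
    (hS : IsClosed (S : Set Γ)) : T ⊆ S := by
  have hT' : IsIrreducible ((↑) ⁻¹' T : Set H) := by
    refine ⟨⟨1, h1⟩, ?_⟩
    rintro _ _ ⟨U, hU, rfl⟩ ⟨V, hV, rfl⟩ ⟨x, hxT, hxU⟩ ⟨y, hyT, hyV⟩
    obtain ⟨z, hzT, hz⟩ := hT.2 U V hU hV ⟨x, hxT, hxU⟩ ⟨y, hyT, hyV⟩
    exact ⟨⟨z, hTH hzT⟩, hzT, hz⟩
  have := hT'.subset_of_finiteIndex h1 (S.subgroupOf H) (hS.preimage continuous_subtype_val)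
  exact fun x hx => this (show (⟨x, hTH hx⟩ : H) ∈ _ from hx)

theorem exists_isIrreducible_isFiniteRelIndex [NoetherianSpace Γ] (H : Subgroup Γ)
    (hH : IsClosed (H : Set Γ)) :
    ∃ S ≤ H, S.IsFiniteRelIndex H ∧ IsClosed (S : Set Γ) ∧ IsIrreducible (S : Set Γ) := by
  have : NoetherianSpace H := Topology.IsInducing.subtypeVal.noetherianSpace
  obtain ⟨T, hT, hTc, hTi⟩ := exists_isIrreducible_finiteIndex H
  have himg : ((T.map H.subtype : Subgroup Γ) : Set Γ) = (↑) '' (T : Set H) := rfl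
  refine ⟨T.map H.subtype, Subgroup.map_subtype_le T, ⟨?_⟩, ?_, ?_⟩
  · rw [Subgroup.relIndex, Subgroup.subgroupOf, Subgroup.comap_map_eq_self_of_injective
      H.subtype_injective]
    exact hT.index_ne_zero
  · rw [himg]
    exact hH.isClosedEmbedding_subtypeVal.isClosedMap _ hTc
  · rw [himg]
    exact hTi.image _ continuous_subtype_val.continuousOn

end RelativeFiniteIndex
open Polynomial

section PowerReparametrization

variable {k : Type*} [Field k] [CharZero k] [IsAlgClosed k]

/-- If `X ↦ X ^ N` is injective on the (nonzero) roots of `p`, then a nonzero `h` for which `p`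
divides `h(X ^ N)` has degree at least that of `p`. -/
theorem Polynomial.natDegree_le_of_dvd_expand {N : ℕ} (hN : 0 < N) (p : k[X]) (hp : p ≠ 0)
    (h0 : ¬ p.IsRoot 0) (hinj : ∀ a b, p.IsRoot a → p.IsRoot b → a ^ N = b ^ N → a = b)
    (h : k[X]) (hh : h ≠ 0) (hdvd : p ∣ expand k N h) : p.natDegree ≤ h.natDegree := by
  induction hd : p.natDegree generalizing p h with
  | zero => exact Nat.zero_le _
  | succ d ih =>
    obtain ⟨a, ha⟩ := IsAlgClosed.exists_root p (by
      intro hdeg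
      rw [natDegree_eq_of_degree_eq_some hdeg] at hd
      simp at hd)
    have ha0 : a ≠ 0 := fun h => h0 (h ▸ ha)
    obtain ⟨p₁, rfl⟩ := dvd_iff_isRoot.2 ha
    have hp₁ : p₁ ≠ 0 := right_ne_zero_of_mul hp
    have hroot : h.IsRoot (a ^ N) := by
      have : (expand k N h).IsRoot a := IsRoot.dvd ha hdvd
      simpa [IsRoot, expand_eval] using this
    obtain ⟨h₁, rfl⟩ := dvd_iff_isRoot.2 hroot
    have hh₁ : h₁ ≠ 0 := right_ne_zero_of_mul hh
    obtain ⟨c, hc⟩ : X - C a ∣ (X ^ N - C (a ^ N) : k[X]) := by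
      rw [dvd_iff_isRoot]; simp
    have hdvd₁ : p₁ ∣ c * expand k N h₁ := by
      have h2 : expand k N ((X - C (a ^ N)) * h₁) = (X - C a) * (c * expand k N h₁) := by
        rw [map_mul, map_sub, expand_X, expand_C, hc, mul_assoc]
      rw [h2] at hdvd
      exact (mul_dvd_mul_iff_left (X_sub_C_ne_zero a)).1 hdvd
    have hcop : IsCoprime p₁ c := by
      by_contra hnot
      obtain ⟨b, hb₁, hb₂⟩ : ∃ b, p₁.IsRoot b ∧ c.IsRoot b := by
        by_contra! hcon
        refine hnot (isCoprime_of_dvd _ _ (fun hz => hp₁ hz.1) ?_)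
        intro z hz hz0 h1 h2
        obtain ⟨b, hb⟩ := IsAlgClosed.exists_root z (by
          intro h
          exact hz (isUnit_iff_degree_eq_zero.2 h))
        exact hcon b (IsRoot.dvd hb h1) (IsRoot.dvd hb h2)
      have hpow : b ^ N = a ^ N := by
        have := IsRoot.dvd hb₂ (Dvd.intro_left _ hc.symm)
        simpa [IsRoot, sub_eq_zero] using this
      have hba : b = a := hinj b a (hb₁.dvd (Dvd.intro_left _ rfl)) ha hpow
      subst hba
      have hder := congrArg (fun q => eval b (derivative q)) hc
      simp only [derivative_sub, derivative_X_pow, derivative_C, sub_zero, eval_mul, eval_pow,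
        eval_X, derivative_mul, derivative_X, eval_add, eval_sub, eval_C, sub_self,
        zero_mul, add_zero, one_mul, eval_natCast, map_natCast] at hder
      rw [hb₂] at hder
      have : (N : k) * b ^ (N - 1) ≠ 0 :=
        mul_ne_zero (Nat.cast_ne_zero.2 hN.ne') (pow_ne_zero _ ha0)
      exact this hder
    have hdeg : p₁.natDegree = d := by
      rw [natDegree_mul (X_sub_C_ne_zero a) hp₁, natDegree_X_sub_C] at hd
      omega
    have := ih p₁ hp₁ (fun hr => h0 (hr.dvd (Dvd.intro_left _ rfl)))
      (fun x y hx hy => hinj x y (hx.dvd (Dvd.intro_left _ rfl)) (hy.dvd (Dvd.intro_left _ rfl)))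
      h₁ hh₁ (hcop.dvd_of_dvd_mul_left hdvd₁) hdeg
    rw [natDegree_mul (X_sub_C_ne_zero _) hh₁, natDegree_X_sub_C]
    omega

/-- If `X ↦ X ^ N` is injective on the (nonzero) roots of `p`, then `X` is congruent modulo `p` to
a polynomial in `X ^ N`. -/
theorem Polynomial.exists_dvd_expand_sub_X {N : ℕ} (hN : 0 < N) (p : k[X]) (hp : p.Monic)
    (h0 : ¬ p.IsRoot 0) (hinj : ∀ a b, p.IsRoot a → p.IsRoot b → a ^ N = b ^ N → a = b) :
    ∃ h : k[X], p ∣ expand k N h - X := by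
  let f : degreeLT k p.natDegree →ₗ[k] AdjoinRoot p :=
    (AdjoinRoot.mkₐ p).toLinearMap ∘ₗ (expand k N).toLinearMap ∘ₗ (degreeLT k p.natDegree).subtype
  have hf : ∀ h, f h = AdjoinRoot.mk p (expand k N h) := fun _ => rfl
  have : FiniteDimensional k (AdjoinRoot p) := hp.finite_adjoinRoot
  have hinjf : Function.Injective f := by
    rw [← LinearMap.ker_eq_bot, LinearMap.ker_eq_bot']
    rintro ⟨h, hh⟩ hfh
    rw [hf, AdjoinRoot.mk_eq_zero] at hfh
    by_contra hne
    have hne' : h ≠ 0 := fun h => hne (Subtype.ext h)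
    have := natDegree_le_of_dvd_expand hN p hp.ne_zero h0 hinj h hne' hfh
    rw [mem_degreeLT, degree_eq_natDegree hne'] at hh
    exact absurd (Nat.cast_lt.1 hh) (not_lt.2 this)
  have hsurj : Function.Surjective f := by
    refine (LinearMap.injective_iff_surjective_of_finrank_eq_finrank ?_).1 hinjf
    rw [(degreeLTEquiv k p.natDegree).finrank_eq, Module.finrank_fin_fun,
      (AdjoinRoot.powerBasis' hp).finrank]
    rfl
  obtain ⟨h, hh⟩ := hsurj (AdjoinRoot.mk p X)
  refine ⟨h, ?_⟩
  rw [hf] at hh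
  rw [← AdjoinRoot.mk_eq_zero, map_sub, hh, sub_self]

end PowerReparametrization

section Recurrence

variable {k : Type*} [Field k]

variable (k) in
/-- The shift operator on two-sided sequences. -/
def seqShift : Module.End k (ℤ → k) := LinearMap.funLeft k k fun j => j + 1

theorem seqShift_pow_apply (i : ℕ) (u : ℤ → k) (j : ℤ) : (seqShift k ^ i) u j = u (j + i) := by
  induction i generalizing j with
  | zero => simp
  | succ i ih =>
    rw [pow_succ', Module.End.mul_apply]
    change (seqShift k ^ i) u (j + 1) = _
    rw [ih]
    congr 1
    push_cast
    ring

theorem aeval_seqShift_expand_apply (m : ℕ) (h : k[X]) (u : ℤ → k) :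
    aeval (seqShift k) (expand k m h) u 0 = h.sum fun i c => c * u (m * i) := by
  rw [expand_aeval, aeval_eq_sum_range, Polynomial.sum_over_range _ (by simp)]
  simp [LinearMap.sum_apply, ← pow_mul, seqShift_pow_apply]

/-- Let `u` satisfy a linear recurrence with characteristic polynomial `q`. If ratios of
roots of `q` that are torsion are killed by `m`, then the vanishing of `u` on the multiples of
`m * N` forces `u m = 0`. -/
theorem eq_zero_of_recurrence [CharZero k] [IsAlgClosed k] (q : k[X]) (hq : q.Monic)
    (h0 : ¬ q.IsRoot 0) (u : ℤ → k) (hu : aeval (seqShift k) q u = 0) {m N : ℕ}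
    (hN : 0 < N)
    (hroots : ∀ a b, q.IsRoot a → q.IsRoot b → a ^ (m * N) = b ^ (m * N) → a ^ m = b ^ m)
    (hvan : ∀ i : ℕ, u (m * N * i) = 0) : u m = 0 := by
  set p : k[X] := (q.roots.map fun a => X - C (a ^ m)).prod with hpdef
  have hpm : p.Monic := monic_multiset_prod_of_monic _ _ fun a _ => monic_X_sub_C _
  have hproot : ∀ x, p.IsRoot x → ∃ a, q.IsRoot a ∧ a ^ m = x := by
    intro x hx
    rw [IsRoot, hpdef, eval_multiset_prod, Multiset.prod_eq_zero_iff] at hx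
    simp only [Multiset.map_map, Multiset.mem_map, Function.comp, eval_sub, eval_X, eval_C] at hx
    obtain ⟨a, ha, hxa⟩ := hx
    exact ⟨a, isRoot_of_mem_roots ha, (sub_eq_zero.1 hxa).symm⟩
  obtain ⟨h, hh⟩ := exists_dvd_expand_sub_X hN p hpm
    (by
      intro hr
      obtain ⟨a, ha, ham⟩ := hproot 0 hr
      exact h0 (eq_zero_of_pow_eq_zero ham ▸ ha))
    (by
      intro x y hx hy hxy
      obtain ⟨a, ha, rfl⟩ := hproot x hx
      obtain ⟨b, hb, rfl⟩ := hproot y hy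
      exact hroots a b ha hb (by rwa [pow_mul, pow_mul]))
  have hqp : q ∣ expand k m p := by
    have hqs : q = (q.roots.map fun a => X - C a).prod :=
      (IsAlgClosed.splits q).eq_prod_roots_of_monic hq
    refine hqs.dvd.trans ?_
    rw [hpdef, map_multiset_prod, Multiset.map_map]
    refine Multiset.prod_dvd_prod_of_dvd _ _ fun a _ => ?_
    simp only [Function.comp, map_sub, expand_X, expand_C]
    rw [dvd_iff_isRoot]
    simp
  have hdvd : q ∣ expand k (m * N) h - X ^ m := by
    have := map_dvd (expand k m) hh
    rw [map_sub, expand_expand, expand_X] at this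
    exact hqp.trans this
  obtain ⟨r, hr⟩ := hdvd
  have h1 : aeval (seqShift k) (expand k (m * N) h - X ^ m) u = 0 := by
    rw [hr, mul_comm, map_mul, Module.End.mul_apply, hu, map_zero]
  have h2 := congrFun h1 0
  rw [map_sub, LinearMap.sub_apply, Pi.sub_apply, aeval_seqShift_expand_apply, map_pow, aeval_X,
    seqShift_pow_apply, zero_add, Pi.zero_apply, sub_eq_zero] at h2
  rw [← h2]
  push_cast
  simp [hvan, Polynomial.sum]

end Recurrence

section DegreeBounds

variable {k : Type*} [Field k] [CharZero k]

/-- An integer with bounded totient divides a fixed factorial. -/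
theorem Nat.dvd_factorial_of_totient_le {d j : ℕ} (hj : 0 < j) (h : j.totient ≤ d) :
    j ∣ (2 * d).factorial := by
  rw [Nat.dvd_iff_prime_pow_dvd_dvd]
  intro p e hp hpe
  rcases e with _ | e
  · simp
  refine Nat.dvd_factorial (pow_pos hp.pos _) ?_
  have h1 : (p ^ (e + 1)).totient ≤ d :=
    (Nat.le_of_dvd (Nat.totient_pos.2 hj) (Nat.totient_dvd_of_dvd hpe)).trans h
  rw [Nat.totient_prime_pow_succ hp] at h1
  have h2 : p ≤ 2 * (p - 1) := by have := hp.two_le; omega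
  calc p ^ (e + 1) = p ^ e * p := pow_succ _ _
    _ ≤ p ^ e * (2 * (p - 1)) := Nat.mul_le_mul_left _ h2
    _ = 2 * (p ^ e * (p - 1)) := by ring
    _ ≤ 2 * d := Nat.mul_le_mul_left _ h1

/-- A root of a polynomial of degree `d` over a number field of degree `m` has degree at most
`m * d`. -/
theorem IntermediateField.finrank_adjoin_root_le (F : IntermediateField ℚ k)
    [FiniteDimensional ℚ F] (q : Polynomial F) (hq : q.Monic) (a : k) (ha : aeval a q = 0) :
    FiniteDimensional ℚ (IntermediateField.adjoin ℚ {a}) ∧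
    Module.finrank ℚ (IntermediateField.adjoin ℚ {a}) ≤ Module.finrank ℚ F * q.natDegree := by
  have hintg : IsIntegral F a := ⟨q, hq, ha⟩
  let M := IntermediateField.adjoin F {a}
  have hM : FiniteDimensional F M := IntermediateField.adjoin.finiteDimensional hintg
  have hMQ : FiniteDimensional ℚ M := FiniteDimensional.trans ℚ F M
  have hle : IntermediateField.adjoin ℚ {a} ≤ M.restrictScalars ℚ := by
    rw [IntermediateField.adjoin_simple_le_iff]
    exact IntermediateField.mem_adjoin_simple_self F a
  have hMQ' : FiniteDimensional ℚ (M.restrictScalars ℚ) := hMQ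
  refine ⟨FiniteDimensional.of_injective (IntermediateField.inclusion hle).toLinearMap
    (IntermediateField.inclusion hle).injective, ?_⟩
  calc Module.finrank ℚ (IntermediateField.adjoin ℚ {a}) ≤ Module.finrank ℚ (M.restrictScalars ℚ) :=
        IntermediateField.finrank_le_of_le_right hle
    _ = Module.finrank ℚ F * Module.finrank F M := (Module.finrank_mul_finrank ℚ F M).symm
    _ ≤ Module.finrank ℚ F * q.natDegree := by
        refine Nat.mul_le_mul_left _ ?_
        rw [IntermediateField.adjoin.finrank hintg]
        exact natDegree_le_of_dvd (minpoly.dvd F a ha) hq.ne_zero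

/-- Roots of unity that are ratios of roots of a polynomial of bounded degree over a number field
of bounded degree have bounded order. -/
theorem exists_pow_eq_pow_of_finrank_le (m d : ℕ) :
    ∃ r : ℕ, 0 < r ∧ ∀ F : IntermediateField ℚ k, FiniteDimensional ℚ F →
      Module.finrank ℚ F ≤ m → ∀ q : Polynomial F, q.Monic → q.natDegree ≤ d →
      ∀ a b : k, aeval a q = 0 → aeval b q = 0 → b ≠ 0 → ∀ N : ℕ, 0 < N →
      a ^ N = b ^ N → a ^ r = b ^ r := by
  refine ⟨(2 * ((m * d) * (m * d))).factorial, Nat.factorial_pos _, ?_⟩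
  intro F hF hFm q hq hqd a b ha hb hb0 N hN hab
  obtain ⟨hfa, hda⟩ := F.finrank_adjoin_root_le q hq a ha
  obtain ⟨hfb, hdb⟩ := F.finrank_adjoin_root_le q hq b hb
  set A := IntermediateField.adjoin ℚ {a}
  set B := IntermediateField.adjoin ℚ {b}
  set z := a / b with hz
  have hzN : z ^ N = 1 := by rw [hz, div_pow, hab, div_self (pow_ne_zero _ hb0)]
  have hz : IsPrimitiveRoot z (orderOf z) := IsPrimitiveRoot.orderOf z
  have hpos : 0 < orderOf z := orderOf_pos_iff.2 (isOfFinOrder_iff_pow_eq_one.2 ⟨N, hN, hzN⟩)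
  have hzmem : z ∈ A ⊔ B := div_mem
    ((le_sup_left : A ≤ A ⊔ B) (IntermediateField.mem_adjoin_simple_self ℚ a))
    ((le_sup_right : B ≤ A ⊔ B) (IntermediateField.mem_adjoin_simple_self ℚ b))
  have htot : (orderOf z).totient ≤ (m * d) * (m * d) := by
    have h1 : (minpoly ℚ z).natDegree = (orderOf z).totient := by
      rw [← cyclotomic_eq_minpoly_rat hz hpos, natDegree_cyclotomic]
    have hintg : IsIntegral ℚ z := (hz.isIntegral hpos).tower_top
    rw [← h1, ← IntermediateField.adjoin.finrank hintg]
    have hle : IntermediateField.adjoin ℚ {z} ≤ A ⊔ B :=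
      IntermediateField.adjoin_simple_le_iff.2 hzmem
    calc _ ≤ Module.finrank ℚ (A ⊔ B : IntermediateField ℚ k) :=
          IntermediateField.finrank_le_of_le_right hle
      _ ≤ _ := IntermediateField.finrank_sup_le A B
      _ ≤ _ := Nat.mul_le_mul (hda.trans (Nat.mul_le_mul hFm hqd))
          (hdb.trans (Nat.mul_le_mul hFm hqd))
  have h1 := orderOf_dvd_iff_pow_eq_one.1 (Nat.dvd_factorial_of_totient_le hpos htot)
  rw [div_pow, div_eq_one_iff_eq (pow_ne_zero _ hb0)] at h1
  exact h1

end DegreeBounds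

section MatrixCoordinates

variable {n : ℕ} {k : Type*} [Field k]

/-- The point of affine space given by the entries of an invertible matrix. -/
def matrixPoint (g : GL (Fin n) k) : Fin n × Fin n → k :=
  fun ij => (g : Matrix (Fin n) (Fin n) k) ij.1 ij.2

/-- The substitution on polynomials in matrix entries induced by left multiplication by `A`. -/
noncomputable def leftMulSubst {R : Type*} [CommRing R] (A : Matrix (Fin n) (Fin n) R) :
    MvPolynomial (Fin n × Fin n) R →ₐ[R] MvPolynomial (Fin n × Fin n) R :=
  MvPolynomial.aeval fun ij => ∑ l, MvPolynomial.C (A ij.1 l) * MvPolynomial.X (l, ij.2)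

/-- The substitution on polynomials in matrix entries induced by right multiplication by `A`. -/
noncomputable def rightMulSubst {R : Type*} [CommRing R] (A : Matrix (Fin n) (Fin n) R) :
    MvPolynomial (Fin n × Fin n) R →ₐ[R] MvPolynomial (Fin n × Fin n) R :=
  MvPolynomial.aeval fun ij => ∑ l, MvPolynomial.X (ij.1, l) * MvPolynomial.C (A l ij.2)

theorem aeval_leftMulSubst {R : Type*} [CommRing R] [Algebra R k] (A : Matrix (Fin n) (Fin n) R)
    (g h : GL (Fin n) k) (hg : ∀ i j, algebraMap R k (A i j) = (g : Matrix _ _ k) i j)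
    (p : MvPolynomial (Fin n × Fin n) R) :
    MvPolynomial.aeval (matrixPoint h) (leftMulSubst A p) =
      MvPolynomial.aeval (matrixPoint (g * h)) p := by
  rw [leftMulSubst, ← AlgHom.comp_apply]
  congr 1
  ext ij
  simp [matrixPoint, Matrix.mul_apply, hg]

theorem eval_leftMulSubst (g h : GL (Fin n) k) (p : MvPolynomial (Fin n × Fin n) k) :
    MvPolynomial.eval (matrixPoint h) (leftMulSubst (g : Matrix _ _ k) p) =
      MvPolynomial.eval (matrixPoint (g * h)) p :=
  aeval_leftMulSubst _ g h (fun _ _ => rfl) p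

theorem eval_rightMulSubst (g h : GL (Fin n) k) (p : MvPolynomial (Fin n × Fin n) k) :
    MvPolynomial.eval (matrixPoint h) (rightMulSubst (g : Matrix _ _ k) p) =
      MvPolynomial.eval (matrixPoint (h * g)) p := by
  rw [← MvPolynomial.coe_aeval_eq_eval, ← MvPolynomial.coe_aeval_eq_eval]
  simp only [RingHom.coe_coe]
  rw [rightMulSubst, ← AlgHom.comp_apply]
  congr 1
  ext ij
  simp [matrixPoint, Matrix.mul_apply]

theorem totalDegree_leftMulSubst_monomial_le {R : Type*} [CommRing R]
    (A : Matrix (Fin n) (Fin n) R) (m : Fin n × Fin n →₀ ℕ) :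
    (leftMulSubst A (MvPolynomial.monomial m 1)).totalDegree ≤ m.degree := by
  have h1 : ∀ ij : Fin n × Fin n, (∑ l, MvPolynomial.C (A ij.1 l) *
      (MvPolynomial.X (l, ij.2) : MvPolynomial (Fin n × Fin n) R)).totalDegree ≤ 1 := by
    intro ij
    refine MvPolynomial.totalDegree_finsetSum_le fun l _ => ?_
    refine (MvPolynomial.totalDegree_mul _ _).trans ?_
    rw [MvPolynomial.totalDegree_C, zero_add]
    exact (MvPolynomial.totalDegree_monomial_le _ _).trans (by simp)
  rw [leftMulSubst, MvPolynomial.aeval_monomial, map_one, one_mul, Finsupp.prod]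
  refine (MvPolynomial.totalDegree_finsetProd _ _).trans ?_
  rw [Finsupp.degree]
  refine Finset.sum_le_sum fun ij _ => ?_
  refine (MvPolynomial.totalDegree_pow _ _).trans ?_
  simpa using Nat.mul_le_mul_left (m ij) (h1 ij)

theorem aeval_seqShift_map {F : Type*} [Field F] [Algebra F k] (q : F[X]) (u : ℤ → k) :
    aeval (seqShift k) (q.map (algebraMap F k)) u =
      aeval ((seqShift k).restrictScalars F) q u := by
  induction q using Polynomial.induction_on' with
  | add p q hp hq =>
    rw [Polynomial.map_add, map_add, map_add, LinearMap.add_apply, LinearMap.add_apply, hp, hq]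
  | monomial i c =>
    have : ∀ i, (((seqShift k).restrictScalars F) ^ i) u = (seqShift k ^ i) u := by
      intro i
      induction i with
      | zero => simp
      | succ i ih =>
        rw [pow_succ', pow_succ', Module.End.mul_apply, Module.End.mul_apply, ih]
        rfl
    simp [aeval_monomial, this, Module.algebraMap_end_apply]

/-- The values of a polynomial `f` on the powers of a matrix over a field `F` satisfy a linear
recurrence over `F` of order bounded in terms of `f`. -/
theorem exists_recurrence (f : MvPolynomial (Fin n × Fin n) k)
    {F : Type*} [Field F] [Algebra F k] (g : GL (Fin n) k) (A : Matrix (Fin n) (Fin n) F)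
    (hA : ∀ i j, algebraMap F k (A i j) = (g : Matrix (Fin n) (Fin n) k) i j) :
    ∃ q : Polynomial F, q.Monic ∧
      q.natDegree ≤ (Finsupp.finite_of_degree_le (σ := Fin n × Fin n) f.totalDegree).toFinset.card ∧
      q.coeff 0 ≠ 0 ∧ aeval (seqShift k) (q.map (algebraMap F k))
        (fun j : ℤ => MvPolynomial.eval (matrixPoint (g ^ j)) f) = 0 := by
  classical
  set D := f.totalDegree with hD
  have hfin : {m : Fin n × Fin n →₀ ℕ | m.degree ≤ D}.Finite := Finsupp.finite_of_degree_le D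
  let ψ : (Fin n × Fin n →₀ ℕ) → ℤ → k :=
    fun m j => MvPolynomial.eval (matrixPoint (g ^ j)) (MvPolynomial.monomial m 1)
  set W : Submodule F (ℤ → k) := Submodule.span F (hfin.toFinset.image ψ : Finset (ℤ → k)) with hW
  have hψW : ∀ m : Fin n × Fin n →₀ ℕ, m.degree ≤ D → ψ m ∈ W := fun m hm =>
    Submodule.subset_span (Finset.mem_coe.2 (Finset.mem_image_of_mem _ (by simpa using hm)))
  have hpW : ∀ p : MvPolynomial (Fin n × Fin n) F, p.totalDegree ≤ D →
      (fun j : ℤ => MvPolynomial.aeval (matrixPoint (g ^ j)) p) ∈ W := by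
    intro p hp
    have : (fun j : ℤ => MvPolynomial.aeval (matrixPoint (g ^ j)) p) =
        ∑ m ∈ p.support, p.coeff m • ψ m := by
      funext j
      rw [MvPolynomial.aeval_def, MvPolynomial.eval₂_eq, Finset.sum_apply]
      refine Finset.sum_congr rfl fun m _ => ?_
      rw [Pi.smul_apply, Algebra.smul_def]
      simp [ψ, MvPolynomial.eval_monomial, Finsupp.prod]
    rw [this]
    refine Submodule.sum_mem _ fun m hm => Submodule.smul_mem _ _ (hψW m ?_)
    exact (MvPolynomial.le_totalDegree hm).trans hp
  let E : Module.End F (ℤ → k) := (seqShift k).restrictScalars F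
  have hEW : ∀ w ∈ W, E w ∈ W := by
    intro w hw
    induction hw using Submodule.span_induction with
    | mem x hx =>
      obtain ⟨m, hm, rfl⟩ := Finset.mem_image.1 (Finset.mem_coe.1 hx)
      have hm' : m.degree ≤ D := by simpa using hm
      convert hpW _ ((totalDegree_leftMulSubst_monomial_le A m).trans hm') using 1
      funext j
      rw [aeval_leftMulSubst A g _ hA, ← zpow_one_add, add_comm]
      simp [E, seqShift, ψ, MvPolynomial.aeval_monomial, MvPolynomial.eval_monomial]
    | zero => rw [map_zero]; exact W.zero_mem
    | add x y _ _ hx hy => rw [map_add]; exact W.add_mem hx hy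
    | smul c x _ hx => rw [map_smul]; exact W.smul_mem c hx
  have hWfin : FiniteDimensional F W := FiniteDimensional.span_finset F _
  let T : Module.End F W := E.restrict hEW
  have hTinj : Function.Injective T := by
    intro x y hxy
    refine Subtype.ext (funext fun j => ?_)
    have := congrFun (congrArg Subtype.val hxy) (j - 1)
    simpa [T, E, seqShift] using this
  refine ⟨T.charpoly, T.charpoly_monic, ?_, ?_, ?_⟩
  · rw [LinearMap.charpoly_natDegree]
    exact (finrank_span_finset_le_card _).trans Finset.card_image_le
  · intro h0
    have hdet : LinearMap.det T = 0 := by rw [LinearMap.det_eq_sign_charpoly_coeff, h0, mul_zero]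
    exact (LinearMap.bot_lt_ker_of_det_eq_zero hdet).ne' (LinearMap.ker_eq_bot.2 hTinj)
  · have hkill : ∀ w ∈ W, aeval E T.charpoly w = 0 := by
      intro w hw
      have h1 : ∀ p : Polynomial F, ((aeval T p) ⟨w, hw⟩ : W).1 = aeval E p w := by
        intro p
        induction p using Polynomial.induction_on' with
        | add p q hp hq => simp [hp, hq]
        | monomial i c =>
          simp only [aeval_monomial, Module.End.mul_apply, Module.algebraMap_end_apply,
            Submodule.coe_smul]
          congr 1
          rw [Module.End.pow_restrict i hEW]
          rfl
      rw [← h1, LinearMap.aeval_self_charpoly]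
      rfl
    have hf : (fun j : ℤ => MvPolynomial.eval (matrixPoint (g ^ j)) f) =
        ∑ m ∈ f.support, f.coeff m • ψ m := by
      funext j
      rw [MvPolynomial.eval_eq, Finset.sum_apply]
      refine Finset.sum_congr rfl fun m _ => ?_
      simp [ψ, MvPolynomial.eval_monomial, Finsupp.prod]
    rw [hf, map_sum]
    refine Finset.sum_eq_zero fun m hm => ?_
    rw [map_smul, aeval_seqShift_map, hkill _ (hψW m (MvPolynomial.le_totalDegree hm)), smul_zero]

/-- For matrices with entries of bounded degree, a polynomial vanishing on all powers of some
positive power of the matrix vanishes on a power of bounded exponent. -/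
theorem exists_pow_eval_eq_zero_of_degree_le [CharZero k] [IsAlgClosed k]
    (f : MvPolynomial (Fin n × Fin n) k) (c : ℕ) :
    ∃ r : ℕ, 0 < r ∧ ∀ g : GL (Fin n) k,
      (∃ F : IntermediateField ℚ k, FiniteDimensional ℚ F ∧ Module.finrank ℚ F ≤ c ∧
        ∀ i j, (g : Matrix (Fin n) (Fin n) k) i j ∈ F) →
      ∀ N : ℕ, 0 < N → (∀ i : ℕ, MvPolynomial.eval (matrixPoint ((g ^ N) ^ i)) f = 0) →
        MvPolynomial.eval (matrixPoint (g ^ r)) f = 0 := by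
  obtain ⟨r, hr, hroots⟩ := exists_pow_eq_pow_of_finrank_le (k := k) c
    (Finsupp.finite_of_degree_le (σ := Fin n × Fin n) f.totalDegree).toFinset.card
  refine ⟨r, hr, ?_⟩
  rintro g ⟨F, hF, hFc, hgF⟩ N hN hvan
  obtain ⟨q, hq, hqd, hq0, hrec⟩ := exists_recurrence f g
    (fun i j => (⟨_, hgF i j⟩ : F)) fun _ _ => rfl
  have hzero : ¬ (q.map (algebraMap F k)).IsRoot 0 := by
    rw [IsRoot, ← coeff_zero_eq_eval_zero, coeff_map]
    simpa using hq0
  have h := eq_zero_of_recurrence (q.map (algebraMap F k)) (hq.map _) hzero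
    _ hrec (m := r) hN (fun a b ha hb hab => ?_) (fun i => ?_)
  · simpa using h
  · refine hroots F hF hFc q hq hqd a b ?_ ?_ ?_ (r * N) (Nat.mul_pos hr hN) hab
    · simpa [IsRoot, eval_map_algebraMap] using ha
    · simpa [IsRoot, eval_map_algebraMap] using hb
    · rintro rfl
      exact hzero hb
  · have := hvan (r * i)
    rw [← pow_mul] at this
    have he : ((r : ℤ) * N * i) = ((N * (r * i) : ℕ) : ℤ) := by push_cast; ring
    rw [he, zpow_natCast, this]

end MatrixCoordinates

section PowerMap

variable {n : ℕ} {k : Type*} [Field k]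

/-- The substitution on polynomials in matrix entries induced by the `r`-th power map. -/
noncomputable def powSubst (n : ℕ) (k : Type*) [Field k] (r : ℕ) :
    MvPolynomial (Fin n × Fin n) k →ₐ[k] MvPolynomial (Fin n × Fin n) k :=
  MvPolynomial.aeval fun ij => (Matrix.mvPolynomialX (Fin n) (Fin n) k ^ r) ij.1 ij.2

theorem eval_powSubst (r : ℕ) (g : GL (Fin n) k) (p : MvPolynomial (Fin n × Fin n) k) :
    MvPolynomial.eval (matrixPoint g) (powSubst n k r p) =
      MvPolynomial.eval (matrixPoint (g ^ r)) p := by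
  rw [← MvPolynomial.coe_aeval_eq_eval, ← MvPolynomial.coe_aeval_eq_eval]
  simp only [RingHom.coe_coe]
  rw [powSubst, ← AlgHom.comp_apply]
  congr 1
  ext ij
  have h1 : (MvPolynomial.aeval (R := k) (matrixPoint g)).mapMatrix
      (Matrix.mvPolynomialX (Fin n) (Fin n) k) = (g : Matrix (Fin n) (Fin n) k) := by
    ext i j
    simp [matrixPoint]
  have h2 : (MvPolynomial.aeval (R := k) (matrixPoint g)).mapMatrix
      (Matrix.mvPolynomialX (Fin n) (Fin n) k ^ r) = (g : Matrix (Fin n) (Fin n) k) ^ r := by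
    rw [map_pow, h1]
  have h3 := congrFun (congrFun h2 ij.1) ij.2
  simp only [AlgHom.mapMatrix_apply, Matrix.map_apply] at h3
  simpa only [MvPolynomial.aeval_X, AlgHom.comp_apply, matrixPoint, Units.val_pow_eq_pow_val]
    using h3

/-- The ideal of polynomials in matrix entries vanishing at the identity matrix. -/
noncomputable def identityIdeal (n : ℕ) (k : Type*) [Field k] :
    Ideal (MvPolynomial (Fin n × Fin n) k) :=
  RingHom.ker (MvPolynomial.eval (matrixPoint (1 : GL (Fin n) k)))

theorem sub_C_eval_mem_identityIdeal (f : MvPolynomial (Fin n × Fin n) k) :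
    f - MvPolynomial.C (MvPolynomial.eval (matrixPoint (1 : GL (Fin n) k)) f) ∈
      identityIdeal n k := by
  simp [identityIdeal, RingHom.mem_ker]

theorem mvPolynomialX_pow_sub_mem (r : ℕ) (i j : Fin n) :
    (Matrix.mvPolynomialX (Fin n) (Fin n) k ^ r - 1 -
      (r : ℕ) • (Matrix.mvPolynomialX (Fin n) (Fin n) k - 1)) i j ∈ identityIdeal n k ^ 2 := by
  set Y := Matrix.mvPolynomialX (Fin n) (Fin n) k with hY
  have hY1 : ∀ i j, (Y - 1) i j ∈ identityIdeal n k := by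
    intro i j
    have := sub_C_eval_mem_identityIdeal (MvPolynomial.X (i, j) : MvPolynomial (Fin n × Fin n) k)
    convert this using 1
    by_cases hij : i = j <;> simp [hY, matrixPoint, hij]
  induction r generalizing i j with
  | zero => simp
  | succ r ih =>
    have h : Y ^ (r + 1) - 1 - (r + 1) • (Y - 1) =
        (Y ^ r - 1 - r • (Y - 1)) * Y + r • ((Y - 1) * (Y - 1)) := by
      rw [pow_succ]
      simp only [sub_mul, mul_sub, smul_mul_assoc, smul_sub, add_smul, one_smul, one_mul, mul_one]
      abel
    rw [h, Matrix.add_apply, Matrix.mul_apply, Matrix.smul_apply, Matrix.mul_apply]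
    refine Ideal.add_mem _ (Ideal.sum_mem _ fun l _ => Ideal.mul_mem_right _ _ (ih i l))
      (nsmul_mem (Ideal.sum_mem _ fun l _ => ?_) _)
    rw [pow_two]
    exact Ideal.mul_mem_mul (hY1 _ _) (hY1 _ _)

theorem powSubst_sub_mem_sq (r : ℕ) (f : MvPolynomial (Fin n × Fin n) k) :
    powSubst n k r f - MvPolynomial.C (MvPolynomial.eval (matrixPoint (1 : GL (Fin n) k)) f) -
      (r : MvPolynomial (Fin n × Fin n) k) *
        (f - MvPolynomial.C (MvPolynomial.eval (matrixPoint (1 : GL (Fin n) k)) f)) ∈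
      identityIdeal n k ^ 2 := by
  induction f using MvPolynomial.induction_on with
  | C a =>
    have : powSubst n k r (MvPolynomial.C a) = MvPolynomial.C a := by simp [powSubst]
    simp [this]
  | add p q hp hq =>
    convert Ideal.add_mem _ hp hq using 1
    simp only [map_add]
    ring
  | mul_X p ij hp =>
    have hX : powSubst n k r (MvPolynomial.X ij) -
        MvPolynomial.C (MvPolynomial.eval (matrixPoint (1 : GL (Fin n) k)) (MvPolynomial.X ij)) -
        (r : MvPolynomial (Fin n × Fin n) k) * (MvPolynomial.X ij - MvPolynomial.C
          (MvPolynomial.eval (matrixPoint (1 : GL (Fin n) k)) (MvPolynomial.X ij))) ∈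
        identityIdeal n k ^ 2 := by
      obtain ⟨i, j⟩ := ij
      convert mvPolynomialX_pow_sub_mem (k := k) r i j using 1
      rw [Matrix.sub_apply, Matrix.sub_apply, Matrix.smul_apply, nsmul_eq_mul]
      by_cases hij : i = j <;> simp [powSubst, matrixPoint, Matrix.one_apply, hij]
    have hu := sub_C_eval_mem_identityIdeal p
    have hv := sub_C_eval_mem_identityIdeal (k := k) (MvPolynomial.X ij)
    simp only [map_mul]
    generalize hx : (MvPolynomial.X ij : MvPolynomial (Fin n × Fin n) k) = x at *
    generalize MvPolynomial.C (MvPolynomial.eval (matrixPoint (1 : GL (Fin n) k)) p) = a at *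
    generalize MvPolynomial.C (MvPolynomial.eval (matrixPoint (1 : GL (Fin n) k)) x) = b at *
    generalize powSubst n k r p = p' at *
    generalize powSubst n k r x = x' at *
    have huv : (p - a) * (x - b) ∈ identityIdeal n k ^ 2 := by
      rw [pow_two]
      exact Ideal.mul_mem_mul hu hv
    have := Ideal.add_mem _ (Ideal.add_mem _ (Ideal.mul_mem_left _ x' hp)
      (Ideal.mul_mem_left _ (a + r * (p - a)) hX))
      (Ideal.mul_mem_left _ ((r : MvPolynomial _ k) * r - r) huv)
    convert this using 1
    ring

theorem powSubst_sub_pow_mul_mem (r j : ℕ) {f : MvPolynomial (Fin n × Fin n) k}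
    (hf : f ∈ identityIdeal n k ^ j) :
    powSubst n k r f - (r : MvPolynomial (Fin n × Fin n) k) ^ j * f ∈
      identityIdeal n k ^ (j + 1) := by
  have h1 : ∀ v ∈ identityIdeal n k,
      powSubst n k r v - (r : MvPolynomial (Fin n × Fin n) k) * v ∈ identityIdeal n k ^ 2 := by
    intro v hv
    have hv0 : MvPolynomial.eval (matrixPoint (1 : GL (Fin n) k)) v = 0 := hv
    simpa [hv0] using powSubst_sub_mem_sq r v
  have h2 : ∀ v ∈ identityIdeal n k, powSubst n k r v ∈ identityIdeal n k := by
    intro v hv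
    have := Ideal.add_mem _ (Ideal.pow_le_self two_ne_zero (h1 v hv))
      (Ideal.mul_mem_left _ (r : MvPolynomial (Fin n × Fin n) k) hv)
    simpa using this
  induction j generalizing f with
  | zero =>
    have := sub_C_eval_mem_identityIdeal f
    have h := powSubst_sub_mem_sq r f
    have h' := Ideal.sub_mem _ (Ideal.add_mem _ (Ideal.pow_le_self two_ne_zero h)
      (Ideal.mul_mem_left _ (r : MvPolynomial (Fin n × Fin n) k) this)) this
    rw [zero_add, pow_one, pow_zero, one_mul]
    convert h' using 1
    ring
  | succ j ih =>
    rw [pow_succ] at hf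
    induction hf using Submodule.mul_induction_on' with
    | mem_mul_mem u hu v hv =>
      have h3 := Ideal.mul_mem_mul (ih hu) (h2 v hv)
      have h4 := Ideal.mul_mem_left _ ((r : MvPolynomial (Fin n × Fin n) k) ^ j)
        (Ideal.mul_mem_mul hu (h1 v hv))
      rw [← pow_succ] at h3
      rw [← pow_add] at h4
      convert Ideal.add_mem _ h3 h4 using 1
      rw [map_mul]
      ring
    | add x _ y _ hx hy =>
      convert Ideal.add_mem _ hx hy using 1
      rw [map_add]
      ring

/-- If `I` is a prime ideal vanishing at the identity and stable under the `r`-th power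
substitution, then the induced endomorphism of the quotient by `I` is injective. -/
theorem mem_of_powSubst_mem [CharZero k] {I : Ideal (MvPolynomial (Fin n × Fin n) k)} [I.IsPrime]
    (hI : I ≤ identityIdeal n k) {r : ℕ} (hr : 0 < r) (hφ : ∀ f ∈ I, powSubst n k r f ∈ I)
    {f : MvPolynomial (Fin n × Fin n) k} (hf : powSubst n k r f ∈ I) : f ∈ I := by
  classical
  by_contra hfI
  have hsurj := Ideal.Quotient.mk_surjective (I := I)
  set J := (identityIdeal n k).map (Ideal.Quotient.mk I) with hJ
  have hJtop : J ≠ ⊤ := by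
    intro h
    have h1 : (1 : MvPolynomial (Fin n × Fin n) k ⧸ I) ∈ J := h ▸ Submodule.mem_top
    obtain ⟨a, ha, ha1⟩ := (Ideal.mem_map_iff_of_surjective _ hsurj).1 h1
    rw [← map_one (Ideal.Quotient.mk I), Ideal.Quotient.eq] at ha1
    have := Ideal.sub_mem _ ha (hI ha1)
    simp [identityIdeal, RingHom.mem_ker] at this
  have hex : ∃ j, Ideal.Quotient.mk I f ∉ J ^ j := by
    by_contra! hall
    have : Ideal.Quotient.mk I f ∈ (⨅ i : ℕ, J ^ i) := Ideal.mem_iInf.2 hall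
    rw [Ideal.iInf_pow_eq_bot_of_isDomain J hJtop, Ideal.mem_bot, Ideal.Quotient.eq_zero_iff_mem]
      at this
    exact hfI this
  obtain ⟨j, hj⟩ : ∃ j, Nat.find hex = j + 1 := Nat.exists_eq_succ_of_ne_zero fun h0 => by
    have := Nat.find_spec hex
    rw [h0, pow_zero, Ideal.one_eq_top] at this
    exact this Submodule.mem_top
  have h1 : Ideal.Quotient.mk I f ∈ J ^ j := not_not.1 (Nat.find_min hex (by omega))
  have h2 : Ideal.Quotient.mk I f ∉ J ^ (j + 1) := hj ▸ Nat.find_spec hex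
  rw [hJ, ← Ideal.map_pow] at h1 h2
  obtain ⟨a, ha, haf⟩ := (Ideal.mem_map_iff_of_surjective _ hsurj).1 h1
  apply h2
  rw [Ideal.Quotient.eq] at haf
  have h3 : powSubst n k r a ∈ I := by
    have := Ideal.add_mem _ (hφ _ haf) hf
    simpa using this
  have h4 := Ideal.mem_map_of_mem (Ideal.Quotient.mk I) (powSubst_sub_pow_mul_mem r j ha)
  rw [map_sub, Ideal.Quotient.eq_zero_iff_mem.2 h3, zero_sub, neg_mem_iff, map_mul,
    Ideal.Quotient.eq.2 haf] at h4
  have h5 := Ideal.mul_mem_left _ (Ideal.Quotient.mk I (MvPolynomial.C (((r : k) ^ j)⁻¹))) h4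
  rw [← mul_assoc, ← map_mul] at h5
  have h6 : (MvPolynomial.C (((r : k) ^ j)⁻¹) : MvPolynomial (Fin n × Fin n) k) *
      (r : MvPolynomial (Fin n × Fin n) k) ^ j = 1 := by
    rw [← map_natCast (MvPolynomial.C (σ := Fin n × Fin n) (R := k)), ← map_pow,
      ← map_mul, inv_mul_cancel₀, map_one]
    exact pow_ne_zero _ (Nat.cast_ne_zero.2 hr.ne')
  rwa [h6, map_one, one_mul] at h5

end PowerMap

section BoundedDegreePoints

variable {k : Type*} [Field k]

/-- A point of affine space lifts along a finite morphism to a point over an algebraically closed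
field. -/
theorem exists_algHom_comp_eq_aeval [IsAlgClosed k] {τ B : Type*} [CommRing B] [Algebra k B]
    (g : MvPolynomial τ k →ₐ[k] B) (hinj : Function.Injective g) (hintg : g.IsIntegral)
    (y : τ → k) : ∃ ψ : B →ₐ[k] k, ψ.comp g = MvPolynomial.aeval y := by
  let alg : Algebra (MvPolynomial τ k) B := g.toRingHom.toAlgebra
  have hAint : Algebra.IsIntegral (MvPolynomial τ k) B := ⟨hintg⟩
  let P : Ideal (MvPolynomial τ k) := RingHom.ker (MvPolynomial.eval y)
  have hP : P.IsMaximal := RingHom.ker_isMaximal_of_surjective _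
    fun c => ⟨MvPolynomial.C c, by simp⟩
  obtain ⟨Q, hQ, hQP⟩ := Ideal.exists_ideal_over_maximal_of_isIntegral (S := B) P (by
    intro x hx
    have : x = 0 := hinj (by rw [map_zero]; exact hx)
    rw [this]
    exact P.zero_mem)
  let _ : Field (B ⧸ Q) := Ideal.Quotient.field Q
  have hcomp : ∀ a : MvPolynomial τ k, Ideal.Quotient.mk Q (g a) =
      algebraMap k (B ⧸ Q) (MvPolynomial.eval y a) := by
    intro a
    have h1 : a - MvPolynomial.C (MvPolynomial.eval y a) ∈ P := by simp [P, RingHom.mem_ker]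
    rw [← hQP, Ideal.mem_comap] at h1
    have h2 : Ideal.Quotient.mk Q (g (a - MvPolynomial.C (MvPolynomial.eval y a))) = 0 :=
      Ideal.Quotient.eq_zero_iff_mem.2 h1
    rw [map_sub, map_sub, sub_eq_zero] at h2
    rw [h2, ← MvPolynomial.algebraMap_eq, AlgHom.commutes]
    rfl
  have hkint : Algebra.IsIntegral k (B ⧸ Q) := by
    refine ⟨fun b => ?_⟩
    obtain ⟨b, rfl⟩ := Ideal.Quotient.mk_surjective b
    obtain ⟨p, hp, hpb⟩ := hintg b
    refine ⟨p.map (MvPolynomial.eval y), hp.map _, ?_⟩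
    rw [eval₂_map]
    have : (algebraMap k (B ⧸ Q)).comp (MvPolynomial.eval y) =
        (Ideal.Quotient.mk Q).comp (g : MvPolynomial τ k →+* B) :=
      RingHom.ext fun a => (hcomp a).symm
    rw [this, ← hom_eval₂]
    exact (congrArg (Ideal.Quotient.mk Q) hpb).trans (map_zero _)
  have hbij := IsAlgClosed.algebraMap_bijective_of_isIntegral (k := k) (K := B ⧸ Q)
  let e : k ≃ₐ[k] (B ⧸ Q) := AlgEquiv.ofBijective (Algebra.ofId k (B ⧸ Q)) hbij
  refine ⟨(e.symm : (B ⧸ Q) →ₐ[k] k).comp (Ideal.Quotient.mkₐ k Q), ?_⟩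
  refine AlgHom.ext fun a => ?_
  apply e.injective
  exact (e.apply_symm_apply _).trans (hcomp a)

theorem IntermediateField.finrank_finset_sup_le [CharZero k] {σ : Type*} (s : Finset σ)
    (E : σ → IntermediateField ℚ k) (c : σ → ℕ)
    (h : ∀ t, FiniteDimensional ℚ (E t) ∧ Module.finrank ℚ (E t) ≤ c t) :
    FiniteDimensional ℚ (s.sup E : IntermediateField ℚ k) ∧
      Module.finrank ℚ (s.sup E : IntermediateField ℚ k) ≤ ∏ t ∈ s, c t := by
  classical
  induction s using Finset.induction_on with
  | empty =>
    rw [Finset.sup_empty, Finset.prod_empty]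
    exact ⟨inferInstance, IntermediateField.finrank_bot.le⟩
  | insert a s ha ih =>
    rw [Finset.sup_insert, Finset.prod_insert ha]
    have := (h a).1
    have := ih.1
    exact ⟨inferInstance, (IntermediateField.finrank_sup_le _ _).trans
      (Nat.mul_le_mul (h a).2 ih.2)⟩

/-- The points of bounded degree over `ℚ` are dense in any irreducible affine variety over an
algebraic closure of `ℚ`. -/
theorem exists_bounded_degree_points_dense [CharZero k] [IsAlgClosed k] [Algebra.IsAlgebraic ℚ k]
    {σ : Type*} [Finite σ] (I : Ideal (MvPolynomial σ k)) [I.IsPrime] :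
    ∃ c : ℕ, ∀ f : MvPolynomial σ k,
      (∀ x : σ → k, (∀ p ∈ I, MvPolynomial.eval x p = 0) →
        (∃ F : IntermediateField ℚ k, FiniteDimensional ℚ F ∧ Module.finrank ℚ F ≤ c ∧
          ∀ t, x t ∈ F) → MvPolynomial.eval x f = 0) → f ∈ I := by
  classical
  have := Fintype.ofFinite σ
  obtain ⟨s, g, hinj, hintg⟩ := exists_integral_inj_algHom_of_fg k (MvPolynomial σ k ⧸ I)
  choose p hp hpx using fun t : σ => hintg (Ideal.Quotient.mk I (MvPolynomial.X t))
  let coeffs : Finset k := Finset.univ.biUnion fun t =>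
    (p t).support.biUnion fun i => ((p t).coeff i).support.image fun m => ((p t).coeff i).coeff m
  let L := IntermediateField.adjoin ℚ (coeffs : Set k)
  have hL : FiniteDimensional ℚ L := IntermediateField.finiteDimensional_adjoin
    fun x _ => (Algebra.IsAlgebraic.isAlgebraic x).isIntegral
  have hcoeff : ∀ t i m, ((p t).coeff i).coeff m ∈ L := by
    intro t i m
    by_cases hi : (p t).coeff i = 0
    · simp [hi]
    by_cases hm : ((p t).coeff i).coeff m = 0
    · simp [hm]
    refine IntermediateField.subset_adjoin _ _ (Finset.mem_coe.2 ?_)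
    simp only [coeffs, Finset.mem_biUnion, Finset.mem_image, Finset.mem_univ, true_and]
    exact ⟨t, i, by simpa using hi, m, by simpa using hm, rfl⟩
  refine ⟨∏ t, Module.finrank ℚ L * (p t).natDegree, fun f hf => ?_⟩
  have hvan : ∀ y ∈ Set.pi Set.univ fun _ : Fin s => Set.range (algebraMap ℚ k),
      ∀ a, Ideal.Quotient.mk I f ∣ g a → MvPolynomial.eval y a = 0 := by
    intro y hy a hfa
    obtain ⟨ψ, hψ⟩ := exists_algHom_comp_eq_aeval g hinj hintg y
    have hψg : ∀ a, ψ (g a) = MvPolynomial.eval y a := fun a => DFunLike.congr_fun hψ a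
    have hx : ∀ q, MvPolynomial.eval (fun t => ψ (Ideal.Quotient.mk I (MvPolynomial.X t))) q =
        ψ (Ideal.Quotient.mk I q) := by
      intro q
      have : MvPolynomial.aeval (fun t => ψ (Ideal.Quotient.mk I (MvPolynomial.X t))) =
          ψ.comp (Ideal.Quotient.mkₐ k I) := by
        ext t
        simp
      exact DFunLike.congr_fun this q
    have hfx := hf (fun t => ψ (Ideal.Quotient.mk I (MvPolynomial.X t))) (fun q hq => by
      rw [hx, Ideal.Quotient.eq_zero_iff_mem.2 hq, map_zero]) (by
      have hdeg : ∀ t, FiniteDimensional ℚ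
          (IntermediateField.adjoin ℚ {ψ (Ideal.Quotient.mk I (MvPolynomial.X t))}) ∧
          Module.finrank ℚ
            (IntermediateField.adjoin ℚ {ψ (Ideal.Quotient.mk I (MvPolynomial.X t))}) ≤
            Module.finrank ℚ L * (p t).natDegree := by
        intro t
        have hlift : (p t).map (MvPolynomial.eval y) ∈ lifts (algebraMap L k) := by
          rw [lifts_iff_coeff_lifts]
          intro i
          rw [coeff_map, MvPolynomial.eval_eq]
          refine ⟨⟨_, sum_mem fun m _ => mul_mem (hcoeff t i m)
            (prod_mem fun j _ => pow_mem ?_ _)⟩, rfl⟩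
          obtain ⟨z, hz⟩ := hy j trivial
          rw [← hz]
          exact L.algebraMap_mem z
        obtain ⟨q, hq, hqd, hqm⟩ := lifts_and_natDegree_eq_and_monic hlift ((hp t).map _)
        have h1 := L.finrank_adjoin_root_le q hqm
          (ψ (Ideal.Quotient.mk I (MvPolynomial.X t))) (by
            rw [← eval_map_algebraMap, hq, eval_map]
            have : MvPolynomial.eval y = (ψ : MvPolynomial σ k ⧸ I →+* k).comp
                (g : MvPolynomial (Fin s) k →+* MvPolynomial σ k ⧸ I) :=
              RingHom.ext fun a => (hψg a).symm
            rw [this]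
            exact (hom_eval₂ (p t) (g : MvPolynomial (Fin s) k →+* MvPolynomial σ k ⧸ I)
              (ψ : MvPolynomial σ k ⧸ I →+* k) _).symm.trans
              ((congrArg ψ (hpx t)).trans (map_zero _)))
        refine ⟨h1.1, h1.2.trans (Nat.mul_le_mul_left _ ?_)⟩
        rw [hqd]
        exact natDegree_map_le
      obtain ⟨h1, h2⟩ := IntermediateField.finrank_finset_sup_le Finset.univ _ _ hdeg
      exact ⟨_, h1, h2, fun t => (Finset.le_sup (f := fun t => IntermediateField.adjoin ℚ
        {ψ (Ideal.Quotient.mk I (MvPolynomial.X t))}) (Finset.mem_univ t))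
          (IntermediateField.mem_adjoin_simple_self ℚ _)⟩)
    rw [hx] at hfx
    obtain ⟨b, hb⟩ := hfa
    rw [← hψg, hb, map_mul, hfx, zero_mul]
  by_contra hfI
  let _ : Algebra (MvPolynomial (Fin s) k) (MvPolynomial σ k ⧸ I) := g.toRingHom.toAlgebra
  have hne : Ideal.Quotient.mk I f ≠ 0 := fun h => hfI (Ideal.Quotient.eq_zero_iff_mem.1 h)
  have hbot := Ideal.comap_ne_bot_of_integral_mem (R := MvPolynomial (Fin s) k) hne
    (Ideal.mem_span_singleton_self _) (hintg _)
  obtain ⟨a, ha, ha0⟩ := Submodule.exists_mem_ne_zero_of_ne_bot hbot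
  refine ha0 (MvPolynomial.funext_set (fun _ : Fin s => Set.range (algebraMap ℚ k))
    (fun _ => Set.infinite_range_of_injective (algebraMap ℚ k).injective) fun y hy => ?_)
  rw [map_zero]
  exact hvan y hy a (Ideal.mem_span_singleton.1 ha)

end BoundedDegreePoints

section ZariskiTopology

variable {n : ℕ} {k : Type*} [Field k]

/-- The prime ideal of polynomials in matrix entries vanishing at a given matrix. -/
noncomputable def matrixPrime (g : GL (Fin n) k) :
    PrimeSpectrum (MvPolynomial (Fin n × Fin n) k) :=
  ⟨RingHom.ker (MvPolynomial.eval (matrixPoint g)), RingHom.ker_isPrime _⟩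

/-- The Zariski topology on the general linear group. -/
@[reducible] noncomputable def zariskiTopology (n : ℕ) (k : Type*) [Field k] :
    TopologicalSpace (GL (Fin n) k) :=
  TopologicalSpace.induced matrixPrime inferInstance

attribute [local instance] zariskiTopology

theorem isClosed_iff_exists_eval {Z : Set (GL (Fin n) k)} :
    IsClosed Z ↔ ∃ s : Set (MvPolynomial (Fin n × Fin n) k),
      Z = {g | ∀ f ∈ s, MvPolynomial.eval (matrixPoint g) f = 0} := by
  rw [isClosed_induced_iff]
  constructor
  · rintro ⟨W, hW, rfl⟩
    obtain ⟨s, rfl⟩ := (PrimeSpectrum.isClosed_iff_zeroLocus W).1 hW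
    exact ⟨s, rfl⟩
  · rintro ⟨s, rfl⟩
    exact ⟨_, PrimeSpectrum.isClosed_zeroLocus s, rfl⟩

theorem isClosed_setOf_eval_eq_zero (f : MvPolynomial (Fin n × Fin n) k) :
    IsClosed {g : GL (Fin n) k | MvPolynomial.eval (matrixPoint g) f = 0} :=
  isClosed_iff_exists_eval.2 ⟨{f}, by simp⟩

theorem mem_closure_iff_eval {A : Set (GL (Fin n) k)} {g : GL (Fin n) k} :
    g ∈ closure A ↔ ∀ f, (∀ a ∈ A, MvPolynomial.eval (matrixPoint a) f = 0) →
      MvPolynomial.eval (matrixPoint g) f = 0 := by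
  constructor
  · intro hg f hf
    exact closure_minimal hf (isClosed_setOf_eval_eq_zero f) hg
  · intro h
    obtain ⟨s, hs⟩ := isClosed_iff_exists_eval.1 (isClosed_closure (s := A))
    rw [hs]
    refine fun f hf => h f fun a ha => ?_
    have ha' := subset_closure ha
    rw [hs] at ha'
    exact ha' f hf

instance zariski_noetherianSpace : NoetherianSpace (GL (Fin n) k) :=
  Topology.IsInducing.noetherianSpace (i := matrixPrime) ⟨rfl⟩

theorem continuous_of_eval_comp {φ : GL (Fin n) k → GL (Fin n) k}
    (h : ∀ f, ∃ f', ∀ g, MvPolynomial.eval (matrixPoint (φ g)) f =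
      MvPolynomial.eval (matrixPoint g) f') : Continuous φ := by
  choose u hu using h
  refine continuous_iff_isClosed.2 fun Z hZ => ?_
  obtain ⟨s, rfl⟩ := isClosed_iff_exists_eval.1 hZ
  refine isClosed_iff_exists_eval.2 ⟨u '' s, ?_⟩
  ext g
  simp [hu]

instance zariski_separatelyContinuousMul : SeparatelyContinuousMul (GL (Fin n) k) where
  continuous_const_mul {g} := continuous_of_eval_comp fun f =>
    ⟨_, fun h => (eval_leftMulSubst g h f).symm⟩
  continuous_mul_const {g} := continuous_of_eval_comp fun f =>
    ⟨_, fun h => (eval_rightMulSubst g h f).symm⟩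

/-- The ideal of polynomials in matrix entries vanishing on a set of invertible matrices. -/
noncomputable def matrixVanishingIdeal (A : Set (GL (Fin n) k)) :
    Ideal (MvPolynomial (Fin n × Fin n) k) :=
  ⨅ g ∈ A, RingHom.ker (MvPolynomial.eval (matrixPoint g))

theorem mem_matrixVanishingIdeal {A : Set (GL (Fin n) k)} {f : MvPolynomial (Fin n × Fin n) k} :
    f ∈ matrixVanishingIdeal A ↔ ∀ g ∈ A, MvPolynomial.eval (matrixPoint g) f = 0 := by
  simp [matrixVanishingIdeal, RingHom.mem_ker]

theorem IsIrreducible.isPrime_matrixVanishingIdeal {A : Set (GL (Fin n) k)}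
    (hA : IsIrreducible A) : (matrixVanishingIdeal A).IsPrime := by
  refine ⟨?_, ?_⟩
  · obtain ⟨g, hg⟩ := hA.1
    rw [Ne, Ideal.eq_top_iff_one, mem_matrixVanishingIdeal]
    intro h
    simpa using h g hg
  · intro p q hpq
    rw [mem_matrixVanishingIdeal] at hpq
    have := isPreirreducible_iff_isClosed_union_isClosed.1 hA.2 _ _
      (isClosed_setOf_eval_eq_zero p) (isClosed_setOf_eval_eq_zero q)
      (fun g hg => by simpa using hpq g hg)
    rwa [mem_matrixVanishingIdeal, mem_matrixVanishingIdeal]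

end ZariskiTopology

section RationalPoints

variable {n : ℕ} {k : Type*} [Field k] [CharZero k]

attribute [local instance] zariskiTopology

/-- The elements of a linear group `G` that are rational over a subfield `L`. -/
def rationalPoints (G : Subgroup (GL (Fin n) k)) (L : IntermediateField ℚ k) :
    Subgroup (GL (Fin n) k) :=
  G ⊓ (Matrix.GeneralLinearGroup.map (n := Fin n) (algebraMap L k)).range

theorem mem_rationalPoints {G : Subgroup (GL (Fin n) k)} {L : IntermediateField ℚ k}
    {g : GL (Fin n) k} : g ∈ rationalPoints G L ↔
      g ∈ G ∧ ∀ i j, (g : Matrix (Fin n) (Fin n) k) i j ∈ L := by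
  refine and_congr_right fun _ => ⟨?_, fun h => ?_⟩
  · rintro ⟨h, rfl⟩ i j
    exact (h i j).2
  · let A : Matrix (Fin n) (Fin n) L := fun i j => ⟨_, h i j⟩
    have hA : (algebraMap L k).mapMatrix A = (g : Matrix (Fin n) (Fin n) k) := rfl
    have hdet : A.det ≠ 0 := by
      intro h0
      have h1 := RingHom.map_det (algebraMap L k) A
      rw [h0, map_zero, hA] at h1
      exact (Matrix.isUnits_det_units g).ne_zero h1.symm
    exact ⟨Matrix.GeneralLinearGroup.mkOfDetNeZero A hdet, Units.ext hA⟩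

theorem rationalPoints_mono (G : Subgroup (GL (Fin n) k)) {L L' : IntermediateField ℚ k}
    (h : L ≤ L') : rationalPoints G L ≤ rationalPoints G L' := fun _ hg =>
  mem_rationalPoints.2 ⟨hg.1, fun i j => h ((mem_rationalPoints.1 hg).2 i j)⟩

/-- An irreducible closed subgroup, each of whose elements has a positive power in a closed
subgroup `S`, is contained in `S`. -/
theorem IsIrreducible.subset_of_forall_exists_pow_mem [IsAlgClosed k] [Algebra.IsAlgebraic ℚ k]
    {T S : Subgroup (GL (Fin n) k)} (hT : IsIrreducible (T : Set (GL (Fin n) k)))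
    (hTc : IsClosed (T : Set (GL (Fin n) k))) (hSc : IsClosed (S : Set (GL (Fin n) k)))
    (hpow : ∀ g ∈ T, ∃ N, 0 < N ∧ g ^ N ∈ S) : T ≤ S := by
  have hprime := hT.isPrime_matrixVanishingIdeal
  obtain ⟨c, hc⟩ := exists_bounded_degree_points_dense
      (matrixVanishingIdeal (T : Set (GL (Fin n) k)))
  have hI1 : matrixVanishingIdeal (T : Set (GL (Fin n) k)) ≤ identityIdeal n k := fun f hf =>
    mem_matrixVanishingIdeal.1 hf 1 T.one_mem
  suffices h : ∀ f, (∀ g ∈ S, MvPolynomial.eval (matrixPoint g) f = 0) →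
      f ∈ matrixVanishingIdeal (T : Set (GL (Fin n) k)) by
    intro g hg
    rw [← SetLike.mem_coe, ← hSc.closure_eq, mem_closure_iff_eval]
    exact fun f hf => mem_matrixVanishingIdeal.1 (h f hf) g hg
  intro f hf
  obtain ⟨r, hr, hroot⟩ := exists_pow_eval_eq_zero_of_degree_le f c
  refine mem_of_powSubst_mem hI1 hr (fun p hp => ?_) ?_
  · rw [mem_matrixVanishingIdeal] at hp ⊢
    intro g hg
    rw [eval_powSubst]
    exact hp _ (T.pow_mem hg r)
  have key : (Matrix.mvPolynomialX (Fin n) (Fin n) k).det * powSubst n k r f ∈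
      matrixVanishingIdeal (T : Set (GL (Fin n) k)) := by
    refine hc _ ?_
    rintro x hx ⟨F, hF, hFc, hxF⟩
    rw [map_mul, Matrix.eval_det_mvPolynomialX]
    by_cases hdet : (Matrix.of fun i j => x (i, j)).det = 0
    · rw [hdet, zero_mul]
    set g := Matrix.GeneralLinearGroup.mkOfDetNeZero _ hdet with hg
    have hgx : matrixPoint g = x := rfl
    have hgT : g ∈ T := by
      rw [← SetLike.mem_coe, ← hTc.closure_eq, mem_closure_iff_eval]
      intro p hp
      rw [hgx]
      exact hx p (mem_matrixVanishingIdeal.2 hp)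
    obtain ⟨N, hN, hgN⟩ := hpow g hgT
    rw [← hgx, eval_powSubst, hroot g ⟨F, hF, hFc, fun i j => hxF (i, j)⟩ N hN
      fun i => hf _ (S.pow_mem hgN i), mul_zero]
  rw [mem_matrixVanishingIdeal] at key ⊢
  intro g hg
  have h := key g hg
  rw [map_mul, Matrix.eval_det_mvPolynomialX] at h
  exact (mul_eq_zero.1 h).resolve_left (Matrix.isUnits_det_units g).ne_zero

theorem exists_finiteDimensional_entries_mem [Algebra.IsAlgebraic ℚ k]
    (L : IntermediateField ℚ k) [FiniteDimensional ℚ L] {t : Set (GL (Fin n) k)} (ht : t.Finite) :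
    ∃ L' : IntermediateField ℚ k, L ≤ L' ∧ FiniteDimensional ℚ L' ∧
      ∀ g ∈ t, ∀ i j, (g : Matrix (Fin n) (Fin n) k) i j ∈ L' := by
  have hfin : (⋃ g ∈ t, Set.range (matrixPoint g)).Finite :=
    ht.biUnion fun g _ => Set.finite_range _
  have := hfin.to_subtype
  have hE : FiniteDimensional ℚ
      (IntermediateField.adjoin ℚ (⋃ g ∈ t, Set.range (matrixPoint g))) :=
    IntermediateField.finiteDimensional_adjoin
      fun x _ => (Algebra.IsAlgebraic.isAlgebraic x).isIntegral
  refine ⟨L ⊔ IntermediateField.adjoin ℚ (⋃ g ∈ t, Set.range (matrixPoint g)), le_sup_left,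
    inferInstance, fun g hg i j => ?_⟩
  exact (le_sup_right : _ ≤ L ⊔ _) (IntermediateField.subset_adjoin _ _
    (Set.mem_biUnion hg ⟨(i, j), rfl⟩))

/-- Over an algebraic closure of `ℚ`, the points of a linear algebraic group over a large enough
number field are Zariski dense. -/
theorem exists_rationalPoints_dense [IsAlgClosed k] [Algebra.IsAlgebraic ℚ k]
    (G : Subgroup (GL (Fin n) k)) (hG : IsClosed (G : Set (GL (Fin n) k))) :
    ∃ L : IntermediateField ℚ k, FiniteDimensional ℚ L ∧
      (G : Set (GL (Fin n) k)) ⊆ closure (rationalPoints G L) := by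
  choose H hH using fun L : IntermediateField ℚ k =>
    exists_subgroup_coe_eq_closure (rationalPoints G L)
  have hHc : ∀ L, IsClosed (H L : Set (GL (Fin n) k)) := fun L => hH L ▸ isClosed_closure
  have hHmono : ∀ {L L'}, L ≤ L' → H L ≤ H L' := fun {L L'} h => by
    rw [← SetLike.coe_subset_coe, hH, hH]
    exact closure_mono (rationalPoints_mono G h)
  have hsub : ∀ L, rationalPoints G L ≤ H L := fun L => by
    rw [← SetLike.coe_subset_coe, hH]
    exact subset_closure
  choose S hSH hSfin hSc hSi using fun L => exists_isIrreducible_isFiniteRelIndex (H L) (hHc L)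
  have hSmono : ∀ {L L'}, L ≤ L' → S L ≤ S L' := fun {L L'} h =>
    (hSi L).subset_of_isFiniteRelIndex (S L).one_mem ((hSH L).trans (hHmono h)) (hSc L')
  let I : IntermediateField ℚ k → Ideal (MvPolynomial (Fin n × Fin n) k) :=
    fun L => matrixVanishingIdeal (S L : Set (GL (Fin n) k))
  have hprime : ∀ L, (I L).IsPrime := fun L => (hSi L).isPrime_matrixVanishingIdeal
  obtain ⟨_, ⟨⟨L, hL⟩, rfl⟩, hmin⟩ := WellFounded.has_min (wellFounded_lt (α := ℕ∞))
    (Set.range fun L : {L : IntermediateField ℚ k // FiniteDimensional ℚ L} => (I L.1).height)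
    ⟨_, ⟨⊥, inferInstance⟩, rfl⟩
  have hstable : ∀ L' : IntermediateField ℚ k, FiniteDimensional ℚ L' → L ≤ L' → S L' ≤ S L := by
    intro L' hL' hle
    have hI : I L' ≤ I L := fun f hf => mem_matrixVanishingIdeal.2 fun g hg =>
      mem_matrixVanishingIdeal.1 hf g (hSmono hle hg)
    have heq : I L' = I L := by
      by_contra hne
      have := hprime L'
      exact hmin _ ⟨⟨L', hL'⟩, rfl⟩ (Ideal.height_strict_mono_of_isPrime (lt_of_le_of_ne hI hne))
    intro g hg
    rw [← SetLike.mem_coe, ← (hSc L).closure_eq, mem_closure_iff_eval]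
    intro f hf
    have : f ∈ I L' := heq ▸ mem_matrixVanishingIdeal.2 hf
    exact mem_matrixVanishingIdeal.1 this g hg
  obtain ⟨T, hTG, hTfin, hTc, hTi⟩ := exists_isIrreducible_isFiniteRelIndex G hG
  have hTS : T ≤ S L := hTi.subset_of_forall_exists_pow_mem hTc (hSc L) fun g hg => by
    obtain ⟨L', hle, hL', hgL'⟩ := exists_finiteDimensional_entries_mem L (Set.finite_singleton g)
    obtain ⟨N, hN, -, hgN⟩ := Subgroup.exists_pow_mem_of_relIndex_ne_zero
      (hSfin L').relIndex_ne_zero (hsub L' (mem_rationalPoints.2 ⟨hTG hg, hgL' g rfl⟩))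
    exact ⟨N, hN, hstable L' hL' hle hgN.1⟩
  have hfi : (T.subgroupOf G).FiniteIndex := ⟨hTfin.relIndex_ne_zero⟩
  obtain ⟨L', hle, hL', hrep⟩ := exists_finiteDimensional_entries_mem L
    (Set.finite_range fun q : G ⧸ T.subgroupOf G => (q.out : GL (Fin n) k))
  refine ⟨L', hL', fun g hg => ?_⟩
  rw [← hH]
  set q : G ⧸ T.subgroupOf G := QuotientGroup.mk ⟨g, hg⟩ with hq
  have h1 : (q.out : GL (Fin n) k) ∈ H L' :=
    hsub L' (mem_rationalPoints.2 ⟨q.out.2, hrep _ ⟨q, rfl⟩⟩)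
  have h2 : (q.out)⁻¹ * ⟨g, hg⟩ ∈ T.subgroupOf G :=
    QuotientGroup.eq.1 (QuotientGroup.out_eq' q)
  have h3 := (H L').mul_mem h1 (hHmono hle (hSH L (hTS h2)))
  simpa using h3

end RationalPoints

section BaseChange

variable {n : ℕ} {k E : Type*} [Field k] [Field E] [Algebra k E]

/-- A polynomial over a field extension is a combination of polynomials over the base field, with
coefficients in a given basis of the extension. -/
theorem MvPolynomial.exists_eq_finsuppSum_basis {σ ι : Type*} (b : Module.Basis ι k E)
    (q : MvPolynomial σ E) : ∃ c : ι →₀ MvPolynomial σ k,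
      q = c.sum fun i p => MvPolynomial.C (b i) * MvPolynomial.map (algebraMap k E) p := by
  classical
  induction q using MvPolynomial.induction_on' with
  | monomial m a =>
    refine ⟨(b.repr a).mapRange (MvPolynomial.monomial m) (map_zero _), ?_⟩
    rw [Finsupp.sum_mapRange_index (by simp)]
    conv_lhs => rw [← b.linearCombination_repr a, Finsupp.linearCombination_apply, Finsupp.sum,
      map_sum]
    refine Finset.sum_congr rfl fun i _ => ?_
    beta_reduce
    rw [MvPolynomial.map_monomial, MvPolynomial.C_mul_monomial, Algebra.smul_def, mul_comm]
  | add p q hp hq =>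
    obtain ⟨c, hc⟩ := hp
    obtain ⟨c', hc'⟩ := hq
    refine ⟨c + c', ?_⟩
    rw [Finsupp.sum_add_index' (by simp) (by simp [mul_add]), ← hc, ← hc']

theorem exists_rational_dense_of_closed [CharZero k] [IsAlgClosed k] [Algebra.IsAlgebraic ℚ k]
    (G : Subgroup (GL (Fin n) k)) (P : Set (MvPolynomial (Fin n × Fin n) k))
    (hG : (G : Set (GL (Fin n) k)) = {g | ∀ p ∈ P, MvPolynomial.eval (matrixPoint g) p = 0}) :
    ∃ L : IntermediateField ℚ k, FiniteDimensional ℚ L ∧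
      ∀ f : MvPolynomial (Fin n × Fin n) k,
        (∀ g ∈ G, (∀ i j, (g : Matrix (Fin n) (Fin n) k) i j ∈ L) →
          MvPolynomial.eval (matrixPoint g) f = 0) →
        ∀ g ∈ G, MvPolynomial.eval (matrixPoint g) f = 0 := by
  let _ := zariskiTopology n k
  obtain ⟨L, hL, hd⟩ := exists_rationalPoints_dense G (isClosed_iff_exists_eval.2 ⟨P, hG⟩)
  exact ⟨L, hL, fun f hf g hg => mem_closure_iff_eval.1 (hd hg) f fun a ha =>
    hf a (mem_rationalPoints.1 ha).1 (mem_rationalPoints.1 ha).2⟩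

theorem aeval_det_mvPolynomialX (x : Fin n × Fin n → E) :
    MvPolynomial.aeval x (Matrix.mvPolynomialX (Fin n) (Fin n) k).det =
      (Matrix.of fun i j => x (i, j)).det := by
  rw [AlgHom.map_det]
  congr 1
  ext i j
  simp [Matrix.mvPolynomialX]

theorem aeval_eq_zero_of_forall_eval_eq_zero [IsAlgClosed k] [IsAlgClosed E]
    (P : Set (MvPolynomial (Fin n × Fin n) k)) {f : MvPolynomial (Fin n × Fin n) k}
    (hf : ∀ g : GL (Fin n) k, (∀ p ∈ P, MvPolynomial.eval (matrixPoint g) p = 0) →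
      MvPolynomial.eval (matrixPoint g) f = 0)
    (g : GL (Fin n) E) (hg : ∀ p ∈ P, MvPolynomial.aeval (matrixPoint g) p = 0) :
    MvPolynomial.aeval (matrixPoint g) f = 0 := by
  have h1 : (Matrix.mvPolynomialX (Fin n) (Fin n) k).det * f ∈ MvPolynomial.vanishingIdeal k
      (MvPolynomial.zeroLocus k (Ideal.span P)) := by
    rw [MvPolynomial.zeroLocus_span, MvPolynomial.mem_vanishingIdeal_iff]
    intro x hx
    by_cases hx0 : (Matrix.of fun i j => x (i, j)).det = 0
    · rw [map_mul, aeval_det_mvPolynomialX, hx0, zero_mul]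
    · have := hf (Matrix.GeneralLinearGroup.mkOfDetNeZero _ hx0) hx
      rw [map_mul]
      exact mul_eq_zero_of_right _ this
  rw [MvPolynomial.vanishingIdeal_zeroLocus_eq_radical,
    ← MvPolynomial.vanishingIdeal_zeroLocus_eq_radical (K := E), MvPolynomial.zeroLocus_span,
    MvPolynomial.mem_vanishingIdeal_iff] at h1
  have h2 := h1 _ hg
  rw [map_mul, aeval_det_mvPolynomialX] at h2
  refine (mul_eq_zero.1 h2).resolve_left ?_
  exact (Matrix.isUnits_det_units g).ne_zero

/-- If the rational points of a linear algebraic group defined over `k` are dense over `k`, they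
remain dense after extending scalars to an algebraically closed field. -/
theorem eval_eq_zero_of_dense [IsAlgClosed k] [IsAlgClosed E]
    (P : Set (MvPolynomial (Fin n × Fin n) k)) (S : Set (GL (Fin n) k))
    (hS : ∀ f : MvPolynomial (Fin n × Fin n) k,
      (∀ g ∈ S, MvPolynomial.eval (matrixPoint g) f = 0) →
        ∀ g : GL (Fin n) k, (∀ p ∈ P, MvPolynomial.eval (matrixPoint g) p = 0) →
          MvPolynomial.eval (matrixPoint g) f = 0)
    (q : MvPolynomial (Fin n × Fin n) E)
    (hq : ∀ g ∈ S, MvPolynomial.eval (fun ij => algebraMap k E (matrixPoint g ij)) q = 0)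
    (g : GL (Fin n) E) (hg : ∀ p ∈ P, MvPolynomial.aeval (matrixPoint g) p = 0) :
    MvPolynomial.eval (matrixPoint g) q = 0 := by
  let b := Module.Basis.ofVectorSpace k E
  obtain ⟨c, rfl⟩ := MvPolynomial.exists_eq_finsuppSum_basis b q
  have hc : ∀ i, ∀ g ∈ S, MvPolynomial.eval (matrixPoint g) (c i) = 0 := by
    intro i h hh
    by_cases hi : i ∈ c.support
    · refine linearIndependent_iff'.1 b.linearIndependent c.support
        (fun i => MvPolynomial.eval (matrixPoint h) (c i)) ?_ i hi
      rw [← hq h hh, Finsupp.sum, map_sum]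
      refine Finset.sum_congr rfl fun j _ => ?_
      rw [map_mul, MvPolynomial.eval_C, MvPolynomial.eval_map, Algebra.smul_def, mul_comm]
      congr 1
      exact (MvPolynomial.eval₂_comp_left (algebraMap k E) (RingHom.id k) _ _)
    · rw [Finsupp.notMem_support_iff.1 hi, map_zero]
  rw [Finsupp.sum, map_sum]
  refine Finset.sum_eq_zero fun i _ => ?_
  rw [map_mul, MvPolynomial.eval_map, ← MvPolynomial.aeval_def,
    aeval_eq_zero_of_forall_eval_eq_zero P (hS _ (hc i)) g hg, mul_zero]

end BaseChange

section RatSubfields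

variable {E : Type*} [Field E] [CharZero E]

theorem Subfield.exists_finiteDimensional_ge {k : Type*} [Field k] [CharZero k] (f : k →+* E)
    (K : Subfield E) [FiniteDimensional ℚ K] (L : IntermediateField ℚ k) [FiniteDimensional ℚ L] :
    ∃ M : Subfield E, K ≤ M ∧ FiniteDimensional ℚ M ∧ ∀ x ∈ L, f x ∈ M := by
  let K' : IntermediateField ℚ E := K.toIntermediateField fun x => by simp
  have hK' : FiniteDimensional ℚ K' :=
    Module.Finite.of_surjective (M := K) (P := K') (AddMonoidHom.toRatLinearMap (AddMonoidHom.id K))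
      Function.surjective_id
  let L₁ : IntermediateField ℚ E := L.map f.toRatAlgHom
  have hL₁ : FiniteDimensional ℚ L₁ :=
    LinearEquiv.finiteDimensional (IntermediateField.equivMap L f.toRatAlgHom).toLinearEquiv
  refine ⟨(K' ⊔ L₁).toSubfield, fun x hx => (le_sup_left : K' ≤ K' ⊔ L₁) hx, ?_, fun x hx =>
    (le_sup_right : L₁ ≤ K' ⊔ L₁) ⟨x, hx, rfl⟩⟩
  have : FiniteDimensional ℚ (K' ⊔ L₁ : IntermediateField ℚ E) := inferInstance
  exact Module.Finite.of_surjective (M := (K' ⊔ L₁ : IntermediateField ℚ E))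
    (P := (K' ⊔ L₁).toSubfield)
    (AddMonoidHom.toRatLinearMap (AddMonoidHom.id (K' ⊔ L₁ : IntermediateField ℚ E)))
    Function.surjective_id

theorem exists_isAlgClosed_algebraic [IsAlgClosed E] :
    ∃ k : IntermediateField ℚ E, IsAlgClosed k ∧ Algebra.IsAlgebraic ℚ k ∧
      ∀ x, IsAlgebraic ℚ x → x ∈ k := by
  refine ⟨algebraicClosure ℚ E, (algebraicClosure.isAlgClosure ℚ E).isAlgClosed, ?_,
    fun _ => mem_algebraicClosure_iff.2⟩
  exact ⟨fun x => (isAlgebraic_algHom_iff (algebraMap (algebraicClosure ℚ E) E).toRatAlgHom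
    (algebraMap (algebraicClosure ℚ E) E).injective).1 (mem_algebraicClosure_iff.1 x.2)⟩

end RatSubfields

/-- A linear algebraic group over an algebraically closed field of characteristic zero which is
defined over a number field has a Zariski dense set of points over some number field. -/
theorem exists_subfield_dense {n : ℕ} {E : Type*} [Field E] [CharZero E] [IsAlgClosed E]
    (K : Subfield E) (hK : FiniteDimensional ℚ K) (P : Set (MvPolynomial (Fin n × Fin n) E))
    (hPK : ∀ p ∈ P, ∀ m : Fin n × Fin n →₀ ℕ, MvPolynomial.coeff m p ∈ K)
    (G : Subgroup (GL (Fin n) E))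
    (hG : ∀ g, g ∈ G ↔ ∀ p ∈ P, MvPolynomial.eval (matrixPoint g) p = 0) :
    ∃ L : Subfield E, K ≤ L ∧ FiniteDimensional ℚ L ∧
      ∀ q : MvPolynomial (Fin n × Fin n) E,
        (∀ g ∈ G, (∀ i j : Fin n, (g : Matrix (Fin n) (Fin n) E) i j ∈ L) →
          MvPolynomial.eval (matrixPoint g) q = 0) →
        ∀ g ∈ G, MvPolynomial.eval (matrixPoint g) q = 0 := by
  have hKalg : ∀ x ∈ K, IsAlgebraic ℚ x := fun x hx =>
    (Algebra.IsAlgebraic.isAlgebraic (R := ℚ) (⟨x, hx⟩ : K)).algHom K.subtype.toRatAlgHom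
  obtain ⟨k, _, _, hk⟩ := exists_isAlgClosed_algebraic (E := E)
  let P₀ : Set (MvPolynomial (Fin n × Fin n) k) := {p | MvPolynomial.map (algebraMap k E) p ∈ P}
  have hP₀ : ∀ p ∈ P, ∃ p₀ ∈ P₀, MvPolynomial.map (algebraMap k E) p₀ = p := by
    intro p hp
    have : p ∈ Set.range (MvPolynomial.map (σ := Fin n × Fin n) (algebraMap k E)) := by
      refine MvPolynomial.mem_range_map_iff_coeffs_subset.2 fun x hx => ?_
      obtain ⟨m, -, rfl⟩ := MvPolynomial.mem_coeffs_iff.1 hx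
      exact ⟨⟨_, hk _ (hKalg _ (hPK p hp m))⟩, rfl⟩
    obtain ⟨p₀, rfl⟩ := this
    exact ⟨p₀, hp, rfl⟩
  let G₀ : Subgroup (GL (Fin n) k) := G.comap (Matrix.GeneralLinearGroup.map (algebraMap k E))
  have hG₀ : (G₀ : Set (GL (Fin n) k)) =
      {g | ∀ p ∈ P₀, MvPolynomial.eval (matrixPoint g) p = 0} := by
    have heval : ∀ (a : GL (Fin n) k) (p : MvPolynomial (Fin n × Fin n) k),
        MvPolynomial.eval (matrixPoint (Matrix.GeneralLinearGroup.map (algebraMap k E) a))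
          (MvPolynomial.map (algebraMap k E) p) = algebraMap k E
            (MvPolynomial.eval (matrixPoint a) p) := fun a p => by
      rw [MvPolynomial.eval_map]
      exact (MvPolynomial.eval₂_comp_left (algebraMap k E) (RingHom.id k) _ _).symm
    ext a
    refine (hG _).trans ⟨fun h p hp => ?_, fun h p hp => ?_⟩
    · exact (algebraMap k E).injective (by rw [← heval, h _ hp, map_zero])
    · obtain ⟨p₀, hp₀, rfl⟩ := hP₀ p hp
      rw [heval, h p₀ hp₀, map_zero]
  obtain ⟨L₀, _, hd⟩ := exists_rational_dense_of_closed G₀ P₀ hG₀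
  obtain ⟨L, hKL, hL, hL₀⟩ := Subfield.exists_finiteDimensional_ge (algebraMap k E) K L₀
  refine ⟨L, hKL, hL, fun q hq g hg => ?_⟩
  refine eval_eq_zero_of_dense P₀ {g | g ∈ G₀ ∧ ∀ i j, (g : Matrix (Fin n) (Fin n) k) i j ∈ L₀}
    ?_ q ?_ g ?_
  · intro f hf g hg
    exact hd f (fun a ha haL => hf a ⟨ha, haL⟩) g (hG₀.ge hg)
  · rintro a ⟨ha, haL⟩
    have h : MvPolynomial.eval
        (matrixPoint (Matrix.GeneralLinearGroup.map (algebraMap k E) a)) q = 0 :=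
      hq (Matrix.GeneralLinearGroup.map (algebraMap k E) a) ha fun i j => hL₀ _ (haL i j)
    exact h
  · intro p hp
    rw [MvPolynomial.aeval_def, ← MvPolynomial.eval_map]
    exact (hG g).1 hg _ hp

/-- Proposition 8.3 of the paper, for linear algebraic groups.
Let `K ⊆ ℂ` be a number field and `G ⊆ GL_n(ℂ)` a subgroup which is the common zero
locus in `GL_n(ℂ)` of a set `P` of polynomials in the matrix entries with
coefficients in `K`. Then there is a finite extension `L` of `K` inside `ℂ` such
that `G ∩ GL_n(L)` is Zariski dense in `G`: every polynomial vanishing on the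
elements of `G` with all entries in `L` vanishes on all of `G`. -/
theorem exists_finite_extension_with_zariski_dense_rational_points
    (K : Subfield ℂ) (hK : FiniteDimensional ℚ K) (n : ℕ)
    (P : Set (MvPolynomial (Fin n × Fin n) ℂ))
    (hPK : ∀ p ∈ P, ∀ m : Fin n × Fin n →₀ ℕ, MvPolynomial.coeff m p ∈ K)
    (G : Subgroup (GL (Fin n) ℂ))
    (hGP : (G : Set (GL (Fin n) ℂ)) =
      {g : GL (Fin n) ℂ | ∀ p ∈ P, MvPolynomial.eval
        (fun ij : Fin n × Fin n => (g : Matrix (Fin n) (Fin n) ℂ) ij.1 ij.2) p = 0}) :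
    ∃ L : Subfield ℂ, K ≤ L ∧ FiniteDimensional ℚ L ∧
      ∀ q : MvPolynomial (Fin n × Fin n) ℂ,
        (∀ g ∈ G, (∀ i j : Fin n, (g : Matrix (Fin n) (Fin n) ℂ) i j ∈ L) →
          MvPolynomial.eval
            (fun ij : Fin n × Fin n => (g : Matrix (Fin n) (Fin n) ℂ) ij.1 ij.2) q = 0) →
        ∀ g ∈ G, MvPolynomial.eval
          (fun ij : Fin n × Fin n => (g : Matrix (Fin n) (Fin n) ℂ) ij.1 ij.2) q = 0 := by
  exact exists_subfield_dense K hK P hPK G (Set.ext_iff.1 hGP)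
end

section
/- Let f : ℂ → ℂ^n be a holomorphic (entire) map and let G ⊆ GL_m(ℂ) be a connected Zariski-closed subgroup (i.e. G is a subgroup of GL_m(ℂ) that is the zero locus in GL_m(ℂ) of a set of polynomials in the matrix entries, and G is connected). Then there exists a holomorphic map g : ℂ → GL_m(ℂ) (all matrix entries are entire functions, and at every z ∈ ℂ the matrix g(z) is invertible) with g(z) ∈ G for all z ∈ ℂ, such that the Zariski closure of {(f(z), g(z)) : z ∈ ℂ} in ℂ^n × ℂ^{m²} equals X̄ × G, where X̄ is the Zariski closure of f(ℂ) in ℂ^n. Concretely: for every polynomial q in n + m² complex variables, q vanishes at (f(z), g(z)) for all z ∈ ℂ if and only if q(x, h) = 0 for every x ∈ ℂ^n lying in the Zariski closure of f(ℂ) and every h ∈ G. -/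
open Filter Topology

section ExpUnit

variable {𝔸 : Type*} [NormedRing 𝔸] [NormedAlgebra ℝ 𝔸] [CompleteSpace 𝔸]

theorem exp_mul_exp_neg_of_real (A : 𝔸) : NormedSpace.exp A * NormedSpace.exp (-A) = 1 := by
  let : NormedAlgebra ℚ 𝔸 := NormedAlgebra.restrictScalars ℚ ℝ 𝔸
  rw [← NormedSpace.exp_add_of_commute (Commute.neg_right (Commute.refl A)), add_neg_cancel,
    NormedSpace.exp_zero]

/-- The exponential of an element of a real Banach algebra, as a unit. -/
noncomputable def expUnit (A : 𝔸) : 𝔸ˣ where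
  val := NormedSpace.exp A
  inv := NormedSpace.exp (-A)
  val_inv := exp_mul_exp_neg_of_real A
  inv_val := by simpa using exp_mul_exp_neg_of_real (-A)

theorem val_expUnit (A : 𝔸) : (expUnit A : 𝔸) = NormedSpace.exp A := rfl

theorem expUnit_zero : expUnit (0 : 𝔸) = 1 := by
  ext; simp [val_expUnit]

theorem expUnit_nsmul (n : ℕ) (A : 𝔸) : expUnit (n • A) = expUnit A ^ n := by
  let : NormedAlgebra ℚ 𝔸 := NormedAlgebra.restrictScalars ℚ ℝ 𝔸
  ext
  rw [val_expUnit, Units.val_pow_eq_pow_val, val_expUnit, NormedSpace.exp_nsmul]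

theorem expUnit_neg (A : 𝔸) : expUnit (-A) = (expUnit A)⁻¹ := by
  ext; rfl

theorem continuous_expUnit : Continuous (expUnit : 𝔸 → 𝔸ˣ) := by
  let : NormedAlgebra ℚ 𝔸 := NormedAlgebra.restrictScalars ℚ ℝ 𝔸
  rw [Units.isOpenEmbedding_val.isInducing.continuous_iff]
  exact NormedSpace.exp_continuous

end ExpUnit

section ClosedSubgroup

variable {𝔸 : Type*} [NormedRing 𝔸]

/-- Limits of directions along which a closed subgroup of units accumulates at the identity
generate one-parameter subgroups. -/
theorem expUnit_smul_mem_of_tendsto [NormedAlgebra ℝ 𝔸] [CompleteSpace 𝔸] {G : Subgroup 𝔸ˣ}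
    (hG : IsClosed (G : Set 𝔸ˣ)) {v : ℕ → 𝔸ˣ} (hv : ∀ k, v k ∈ G) {ε : ℕ → ℝ}
    (hε : ∀ k, 0 < ε k) (hε0 : Tendsto ε atTop (𝓝 0)) {Y : 𝔸}
    (hY : Tendsto (fun k => (ε k)⁻¹ • ((v k : 𝔸) - 1)) atTop (𝓝 Y)) (t : ℝ) :
    expUnit (t • Y) ∈ G := by
  have main : ∀ t : ℝ, 0 ≤ t → expUnit (t • Y) ∈ G := by
    intro t ht
    have hexp : HasStrictFDerivAt (NormedSpace.exp : 𝔸 → 𝔸)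
        ((ContinuousLinearEquiv.refl ℝ 𝔸 : 𝔸 ≃L[ℝ] 𝔸) : 𝔸 →L[ℝ] 𝔸) 0 :=
      hasStrictFDerivAt_exp_zero
    set L := hexp.localInverse with hL
    have hL1 : L 1 = 0 := by
      simpa using hexp.localInverse_apply_image
    have hLd : HasFDerivAt L (ContinuousLinearMap.id ℝ 𝔸) 1 := by
      simpa using! hexp.to_localInverse.hasFDerivAt
    have hLr : ∀ᶠ x in 𝓝 (1 : 𝔸), NormedSpace.exp (L x) = x := by
      simpa using hexp.eventually_right_inverse
    have hdiff : Tendsto (fun k => (v k : 𝔸) - 1) atTop (𝓝 0) := by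
      have := hε0.smul hY
      rw [zero_smul] at this
      refine this.congr fun k => ?_
      rw [smul_inv_smul₀ (hε k).ne']
    have hv1 : Tendsto (fun k => (v k : 𝔸)) atTop (𝓝 1) := by
      simpa using hdiff.add_const 1
    have hlog : Tendsto (fun k => (ε k)⁻¹ • L (v k)) atTop (𝓝 Y) := by
      have := hLd.hasFDerivWithinAt.lim hdiff (.of_forall fun _ => Set.mem_univ _) hY
      simpa [hL1] using this
    have hfloor : Tendsto (fun k => (⌊t / ε k⌋₊ : ℝ) * ε k) atTop (𝓝 t) := by
      refine tendsto_of_tendsto_of_tendsto_of_le_of_le (g := fun k => t - ε k) (h := fun _ => t)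
        (by simpa using hε0.const_sub t) tendsto_const_nhds (fun k => ?_) (fun k => ?_)
      · have := (Nat.lt_floor_add_one (t / ε k)).le
        rw [div_le_iff₀ (hε k)] at this
        simp only
        linarith
      · have := Nat.floor_le (div_nonneg ht (hε k).le)
        rwa [le_div_iff₀ (hε k)] at this
    have hlim : Tendsto (fun k => expUnit (((⌊t / ε k⌋₊ : ℝ) * ε k) • ((ε k)⁻¹ • L (v k)))) atTop
        (𝓝 (expUnit (t • Y))) :=
      (continuous_expUnit.tendsto _).comp (hfloor.smul hlog)
    refine hG.mem_of_tendsto hlim ?_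
    filter_upwards [hv1.eventually hLr] with k hk
    have h1 : ((⌊t / ε k⌋₊ : ℝ) * ε k) • ((ε k)⁻¹ • L (v k)) = ⌊t / ε k⌋₊ • L (v k) := by
      rw [smul_smul, mul_assoc, mul_inv_cancel₀ (hε k).ne', mul_one, Nat.cast_smul_eq_nsmul]
    have h2 : expUnit (L (v k)) = v k := Units.ext hk
    rw [h1, expUnit_nsmul, h2]
    exact G.pow_mem (hv k) _
  rcases le_total 0 t with ht | ht
  · exact main t ht
  · have := G.inv_mem (main (-t) (by linarith))
    rwa [← expUnit_neg, neg_smul, neg_neg] at this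

theorem exists_norm_sub_one_minimal [ProperSpace 𝔸] {Z : Subgroup 𝔸ˣ}
    (hZ : IsClosed (Z : Set 𝔸ˣ)) (g : 𝔸ˣ) (hg : ‖(g : 𝔸) - 1‖ < 1) :
    ∃ z ∈ Z, ∀ y ∈ Z, ‖((g * z : 𝔸ˣ) : 𝔸) - 1‖ ≤ ‖((g * y : 𝔸ˣ) : 𝔸) - 1‖ := by
  set K : Set 𝔸ˣ := Units.val ⁻¹' Metric.closedBall (1 : 𝔸) ‖(g : 𝔸) - 1‖ with hK
  have hKc : IsCompact K := by
    refine Units.isOpenEmbedding_val.isInducing.isCompact_preimage' (isCompact_closedBall _ _) ?_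
    intro a ha
    rw [Metric.mem_closedBall, dist_eq_norm, ← norm_neg, neg_sub] at ha
    exact ⟨Units.oneSub (1 - a) (ha.trans_lt hg), by simp⟩
  have hcl : IsClosed {h : 𝔸ˣ | g⁻¹ * h ∈ Z} := hZ.preimage (continuous_const_mul g⁻¹)
  obtain ⟨h, ⟨hhK, hhZ⟩, hmin⟩ := (hKc.inter_right hcl).exists_isMinOn
    (f := fun h : 𝔸ˣ => ‖(h : 𝔸) - 1‖)
    ⟨g, by simp [hK, dist_eq_norm], by simp [Z.one_mem]⟩
    (Units.continuous_val.sub continuous_const).norm.continuousOn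
  refine ⟨g⁻¹ * h, hhZ, fun y hy => ?_⟩
  rw [mul_inv_cancel_left]
  by_cases hyK : g * y ∈ K
  · exact hmin ⟨hyK, by simpa using hy⟩
  · simp only [hK, Set.mem_preimage, Metric.mem_closedBall, dist_eq_norm, not_le] at hyK hhK
    exact hhK.trans hyK.le

/-- A closed subgroup of a closed subgroup `G` of the unit group of a finite-dimensional real
algebra contains a neighbourhood of the identity in `G` as soon as it contains all one-parameter
subgroups of `G`. -/
theorem exists_nhds_one_of_one_parameter_subgroups [NormedAlgebra ℝ 𝔸] [ProperSpace 𝔸]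
    {G Z : Subgroup 𝔸ˣ}
    (hG : IsClosed (G : Set 𝔸ˣ)) (hZ : IsClosed (Z : Set 𝔸ˣ)) (hZG : Z ≤ G)
    (hexp : ∀ Y : 𝔸, (∀ t : ℝ, expUnit (t • Y) ∈ G) → ∀ t : ℝ, expUnit (t • Y) ∈ Z) :
    ∃ δ > 0, ∀ g ∈ G, ‖(g : 𝔸) - 1‖ < δ → g ∈ Z := by
  by_contra! hcon
  have key : ∀ k : ℕ, ∃ v ∈ G, v ≠ 1 ∧ ‖(v : 𝔸) - 1‖ < 1 / ((k : ℝ) + 1) ∧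
      ∀ z ∈ Z, ‖(v : 𝔸) - 1‖ ≤ ‖((v * z : 𝔸ˣ) : 𝔸) - 1‖ := by
    intro k
    obtain ⟨g, hgG, hg, hgZ⟩ := hcon (1 / ((k : ℝ) + 1)) (by positivity)
    have hle : 1 / ((k : ℝ) + 1) ≤ 1 := by
      rw [div_le_one (by positivity)]; linarith [Nat.cast_nonneg (α := ℝ) k]
    obtain ⟨z, hz, hmin⟩ := exists_norm_sub_one_minimal hZ g (hg.trans_le hle)
    refine ⟨g * z, G.mul_mem hgG (hZG hz), fun h => hgZ ?_, ?_, fun y hy => ?_⟩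
    · rw [eq_inv_of_mul_eq_one_left h]; exact Z.inv_mem hz
    · exact (by simpa using hmin 1 Z.one_mem : _ ≤ ‖(g : 𝔸) - 1‖).trans_lt hg
    · rw [mul_assoc]; exact hmin _ (Z.mul_mem hz hy)
  choose v hvG hv1 hvlt hvmin using key
  set ε : ℕ → ℝ := fun k => ‖(v k : 𝔸) - 1‖ with hεdef
  have hε : ∀ k, 0 < ε k := fun k =>
    norm_pos_iff.2 (sub_ne_zero.2 fun h => hv1 k (Units.ext h))
  have hε0 : Tendsto ε atTop (𝓝 0) :=
    squeeze_zero (fun k => (hε k).le) (fun k => (hvlt k).le) tendsto_one_div_add_atTop_nhds_zero_nat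
  obtain ⟨Y, -, φ, hφ, hYlim⟩ := (isCompact_sphere (0 : 𝔸) 1).tendsto_subseq
    (x := fun k => (ε k)⁻¹ • ((v k : 𝔸) - 1)) (fun k => by
      rw [mem_sphere_zero_iff_norm, norm_smul, norm_inv, Real.norm_of_nonneg (hε k).le]
      exact inv_mul_cancel₀ (hε k).ne')
  have hεφ : Tendsto (ε ∘ φ) atTop (𝓝 0) := hε0.comp hφ.tendsto_atTop
  have hYZ := hexp Y (expUnit_smul_mem_of_tendsto hG (fun k => hvG (φ k)) (fun k => hε (φ k))
    hεφ hYlim)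
  have hd : HasDerivAt (fun t : ℝ => NormedSpace.exp (t • Y)) Y 0 := by
    simpa using hasDerivAt_exp_smul_const (𝕂 := ℝ) Y 0
  have hnegφ : Tendsto (fun k => -(ε (φ k))) atTop (𝓝[≠] 0) := by
    refine tendsto_nhdsWithin_iff.2 ⟨by simpa using hεφ.neg, Eventually.of_forall fun k => ?_⟩
    simpa using (hε (φ k)).ne'
  have hexp1 : Tendsto (fun k => NormedSpace.exp ((-(ε (φ k))) • Y)) atTop (𝓝 1) := by
    have := hd.continuousAt.tendsto.comp (tendsto_nhds_of_tendsto_nhdsWithin hnegφ)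
    rw [zero_smul, NormedSpace.exp_zero] at this
    exact this
  have hslope : Tendsto (fun k => (ε (φ k))⁻¹ • (NormedSpace.exp ((-(ε (φ k))) • Y) - 1)) atTop
      (𝓝 (-Y)) := by
    refine ((hd.tendsto_slope.comp hnegφ).neg).congr fun k => ?_
    simp [slope_def_module]
  have hlim : Tendsto (fun k => (ε (φ k))⁻¹ •
      (((v (φ k) * expUnit ((-(ε (φ k))) • Y) : 𝔸ˣ) : 𝔸) - 1)) atTop (𝓝 0) := by
    have := (hYlim.mul hexp1).add hslope
    rw [mul_one, add_neg_cancel] at this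
    refine this.congr fun k => ?_
    simp only [Function.comp_apply, Units.val_mul, val_expUnit]
    rw [smul_mul_assoc, ← smul_add]
    congr 1
    noncomm_ring
  have hge : ∀ k, 1 ≤ ‖(ε (φ k))⁻¹ •
      (((v (φ k) * expUnit ((-(ε (φ k))) • Y) : 𝔸ˣ) : 𝔸) - 1)‖ := by
    intro k
    rw [norm_smul, norm_inv, Real.norm_of_nonneg (hε _).le, ← inv_mul_cancel₀ (hε (φ k)).ne']
    exact mul_le_mul_of_nonneg_left (hvmin _ _ (hYZ _)) (inv_nonneg.2 (hε _).le)
  have := ge_of_tendsto hlim.norm (Eventually.of_forall hge)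
  rw [norm_zero] at this
  linarith

/-- A connected closed subgroup of the unit group of a finite-dimensional real algebra is
the smallest closed subgroup containing its one-parameter subgroups. -/
theorem le_of_one_parameter_subgroups [NormedAlgebra ℝ 𝔸] [ProperSpace 𝔸]
    {G Z : Subgroup 𝔸ˣ}
    (hG : IsClosed (G : Set 𝔸ˣ)) (hGconn : IsConnected (G : Set 𝔸ˣ))
    (hZ : IsClosed (Z : Set 𝔸ˣ)) (hZG : Z ≤ G)
    (hexp : ∀ Y : 𝔸, (∀ t : ℝ, expUnit (t • Y) ∈ G) → ∀ t : ℝ, expUnit (t • Y) ∈ Z) :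
    G ≤ Z := by
  obtain ⟨δ, hδ, hδZ⟩ := exists_nhds_one_of_one_parameter_subgroups hG hZ hZG hexp
  have : ConnectedSpace G := isConnected_iff_connectedSpace.1 hGconn
  have hopen : IsOpen (Z.subgroupOf G : Set G) := by
    refine Subgroup.isOpen_of_mem_nhds _ (g := 1) ?_
    have hc : Continuous fun g : G => ‖((g : 𝔸ˣ) : 𝔸) - 1‖ :=
      ((Units.continuous_val.comp continuous_subtype_val).sub continuous_const).norm
    filter_upwards [(isOpen_lt hc continuous_const).mem_nhds
      (show (1 : G) ∈ {g : G | ‖((g : 𝔸ˣ) : 𝔸) - 1‖ < δ} by simpa using hδ)] with g hg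
    exact hδZ g g.2 hg
  have huniv : (Z.subgroupOf G : Set G) = Set.univ :=
    IsClopen.eq_univ ⟨hZ.preimage continuous_subtype_val, hopen⟩ ⟨1, Subgroup.one_mem _⟩
  intro g hg
  have : (⟨g, hg⟩ : G) ∈ (Z.subgroupOf G : Set G) := huniv ▸ Set.mem_univ _
  exact this

end ClosedSubgroup

section EntireCurves

variable {𝔸 : Type*} [NormedRing 𝔸] [NormedAlgebra ℂ 𝔸] [CompleteSpace 𝔸]

theorem differentiable_units_inv {g : ℂ → 𝔸ˣ} (hg : Differentiable ℂ fun z => (g z : 𝔸)) :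
    Differentiable ℂ fun z => ((g z)⁻¹.val : 𝔸) := by
  intro z
  have := (differentiableAt_inverse (𝕜 := ℂ) (g z).isUnit).comp z (hg z)
  refine this.congr_of_eventuallyEq (Eventually.of_forall fun w => ?_)
  simp

/-- The elements of `G` that can be joined to the identity by an entire curve in `G`. -/
def entireCurveSubgroup (G : Subgroup 𝔸ˣ) : Subgroup 𝔸ˣ where
  carrier := {h | ∃ θ : ℂ → 𝔸ˣ, Differentiable ℂ (fun t => (θ t : 𝔸)) ∧ (∀ t, θ t ∈ G) ∧
    θ 0 = 1 ∧ θ 1 = h}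
  one_mem' := ⟨fun _ => 1, by simp, fun _ => G.one_mem, rfl, rfl⟩
  mul_mem' := by
    rintro _ _ ⟨θ, hθ, hθG, hθ0, rfl⟩ ⟨η, hη, hηG, hη0, rfl⟩
    exact ⟨fun t => θ t * η t, hθ.mul hη, fun t => G.mul_mem (hθG t) (hηG t),
      by simp [hθ0, hη0], rfl⟩
  inv_mem' := by
    rintro _ ⟨θ, hθ, hθG, hθ0, rfl⟩
    exact ⟨fun t => (θ t)⁻¹, differentiable_units_inv hθ, fun t => G.inv_mem (hθG t),
      by simp [hθ0], rfl⟩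

theorem entireCurveSubgroup_le (G : Subgroup 𝔸ˣ) : entireCurveSubgroup G ≤ G := by
  rintro _ ⟨θ, -, hθG, -, rfl⟩
  exact hθG 1

theorem exists_entire_curve_of_mem {G : Subgroup 𝔸ˣ} {h : 𝔸ˣ} (hh : h ∈ entireCurveSubgroup G) :
    ∃ θ : ℂ → 𝔸ˣ, Differentiable ℂ (fun t => (θ t : 𝔸)) ∧
      (∀ t, θ t ∈ entireCurveSubgroup G) ∧ θ 0 = 1 ∧ θ 1 = h := by
  obtain ⟨θ, hθ, hθG, hθ0, hθ1⟩ := hh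
  refine ⟨θ, hθ, fun t => ⟨fun s => θ (s * t), ?_, fun s => hθG _, by simp [hθ0], by simp⟩, hθ0, hθ1⟩
  exact hθ.comp (differentiable_id.mul_const t)

theorem exists_entire_interpolation (F : Finset ℂ) {w : ℂ} (hwF : w ∉ F) {R : ℝ} (hR : 0 ≤ R)
    (hw : R < ‖w‖) {δ : ℝ} (hδ : 0 < δ) :
    ∃ p : ℂ → ℂ, Differentiable ℂ p ∧ (∀ z ∈ F, p z = 0) ∧ p w = 1 ∧
      ∀ z, ‖z‖ ≤ R → ‖p z‖ < δ := by
  have hw0 : w ≠ 0 := norm_pos_iff.1 (hR.trans_lt hw)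
  set a : ℂ → ℂ := fun z => (∏ c ∈ F, (w - c))⁻¹ * ∏ c ∈ F, (z - c) with ha
  have hprod : ∏ c ∈ F, (w - c) ≠ 0 :=
    Finset.prod_ne_zero_iff.2 fun c hc => sub_ne_zero.2 fun h => hwF (h ▸ hc)
  have had : Differentiable ℂ a := by
    refine Differentiable.const_mul ?_ _
    exact Differentiable.fun_finsetProd fun c _ => differentiable_id.sub_const c
  obtain ⟨C, hC⟩ := (isCompact_closedBall (0 : ℂ) R).exists_bound_of_continuousOn
    had.continuous.continuousOn
  have hρ : R / ‖w‖ < 1 := (div_lt_one (hR.trans_lt hw)).2 hw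
  have hρ0 : 0 ≤ R / ‖w‖ := by positivity
  have hlim : Tendsto (fun M : ℕ => C * (R / ‖w‖) ^ M) atTop (𝓝 0) := by
    simpa using (tendsto_pow_atTop_nhds_zero_of_lt_one hρ0 hρ).const_mul C
  obtain ⟨M, hM⟩ := (hlim.eventually_lt_const hδ).exists
  refine ⟨fun z => a z * (z / w) ^ M, had.mul ((differentiable_id.div_const w).pow M),
    fun z hz => ?_, ?_, fun z hz => ?_⟩
  · simp [ha, Finset.prod_eq_zero hz (sub_self z)]
  · simp [ha, hprod, hw0]
  · refine lt_of_le_of_lt ?_ hM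
    have hCz := hC z (by simpa using hz)
    rw [norm_mul, norm_pow, norm_div]
    gcongr
    exact (norm_nonneg _).trans hCz

/-- An entire curve in the subgroup of points reachable by entire curves can be modified so as to
take a prescribed value at a point far away, with a small change on a given disc and no change on a
given finite set. -/
theorem exists_entire_modification {G : Subgroup 𝔸ˣ} {g : ℂ → 𝔸ˣ}
    (hg : Differentiable ℂ fun z => (g z : 𝔸)) (hgH : ∀ z, g z ∈ entireCurveSubgroup G)
    (F : Finset ℂ) {w : ℂ} (hwF : w ∉ F) {R : ℝ} (hR : 0 ≤ R) (hw : R < ‖w‖) {ε : ℝ} (hε : 0 < ε)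
    {h : 𝔸ˣ} (hh : h ∈ entireCurveSubgroup G) :
    ∃ g' : ℂ → 𝔸ˣ, Differentiable ℂ (fun z => (g' z : 𝔸)) ∧
      (∀ z, g' z ∈ entireCurveSubgroup G) ∧ (∀ z ∈ F, g' z = g z) ∧ g' w = h ∧
      ∀ z, ‖z‖ ≤ R → ‖(g' z : 𝔸) - g z‖ < ε ∧ ‖((g' z)⁻¹.val : 𝔸) - (g z)⁻¹.val‖ < ε := by
  obtain ⟨θ, hθ, hθH, hθ0, hθ1⟩ := exists_entire_curve_of_mem
    ((entireCurveSubgroup G).mul_mem ((entireCurveSubgroup G).inv_mem (hgH w)) hh)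
  obtain ⟨C, hC⟩ := (isCompact_closedBall (0 : ℂ) R).exists_bound_of_continuousOn
    hg.continuous.continuousOn
  obtain ⟨C', hC'⟩ := (isCompact_closedBall (0 : ℂ) R).exists_bound_of_continuousOn
    (differentiable_units_inv hg).continuous.continuousOn
  have hsmall : ∀ᶠ t in 𝓝 (0 : ℂ), C * ‖(θ t : 𝔸) - 1‖ < ε ∧ C' * ‖((θ t)⁻¹.val : 𝔸) - 1‖ < ε := by
    have h1 : Tendsto (fun t => C * ‖(θ t : 𝔸) - 1‖) (𝓝 0) (𝓝 0) := by
      have : Continuous fun t => C * ‖(θ t : 𝔸) - 1‖ :=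
        continuous_const.mul (hθ.continuous.sub continuous_const).norm
      simpa [hθ0] using this.tendsto 0
    have h2 : Tendsto (fun t => C' * ‖((θ t)⁻¹.val : 𝔸) - 1‖) (𝓝 0) (𝓝 0) := by
      have : Continuous fun t => C' * ‖((θ t)⁻¹.val : 𝔸) - 1‖ :=
        continuous_const.mul ((differentiable_units_inv hθ).continuous.sub continuous_const).norm
      simpa [hθ0] using this.tendsto 0
    exact (h1.eventually_lt_const hε).and (h2.eventually_lt_const hε)
  obtain ⟨δ, hδ, hδs⟩ := Metric.eventually_nhds_iff.1 hsmall
  obtain ⟨p, hp, hpF, hpw, hpR⟩ := exists_entire_interpolation F hwF hR hw hδ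
  refine ⟨fun z => g z * θ (p z), ?_, fun z => mul_mem (hgH z) (hθH _), fun z hz => ?_, ?_,
    fun z hz => ?_⟩
  · exact hg.mul (hθ.comp hp)
  · simp [hpF z hz, hθ0]
  · simp [hpw, hθ1]
  · have hz' : z ∈ Metric.closedBall (0 : ℂ) R := by simpa using hz
    obtain ⟨h1, h2⟩ := hδs (y := p z) (by simpa using hpR z hz)
    constructor
    · refine lt_of_le_of_lt ?_ h1
      calc ‖((g z * θ (p z) : 𝔸ˣ) : 𝔸) - g z‖ = ‖(g z : 𝔸) * ((θ (p z) : 𝔸) - 1)‖ := by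
            rw [Units.val_mul, mul_sub, mul_one]
        _ ≤ ‖(g z : 𝔸)‖ * ‖(θ (p z) : 𝔸) - 1‖ := norm_mul_le _ _
        _ ≤ C * ‖(θ (p z) : 𝔸) - 1‖ := by gcongr; exact hC z hz'
    · refine lt_of_le_of_lt ?_ h2
      calc ‖((g z * θ (p z))⁻¹.val : 𝔸) - (g z)⁻¹.val‖
          = ‖(((θ (p z))⁻¹.val : 𝔸) - 1) * ((g z)⁻¹.val : 𝔸)‖ := by
            rw [mul_inv_rev, Units.val_mul, sub_mul, one_mul]
        _ ≤ ‖((θ (p z))⁻¹.val : 𝔸) - 1‖ * ‖((g z)⁻¹.val : 𝔸)‖ := norm_mul_le _ _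
        _ ≤ ‖((θ (p z))⁻¹.val : 𝔸) - 1‖ * C' := by gcongr; exact hC' z hz'
        _ = C' * ‖((θ (p z))⁻¹.val : 𝔸) - 1‖ := mul_comm _ _

theorem exists_ne_zero_of_large_norm {φ : ℂ → ℂ} (hφ : Differentiable ℂ φ) {z₀ : ℂ}
    (hz₀ : φ z₀ ≠ 0) (R : ℝ) : ∃ w, R < ‖w‖ ∧ φ w ≠ 0 := by
  by_contra! hcon
  refine hz₀ ?_
  have han : AnalyticOnNhd ℂ φ Set.univ := fun z _ => hφ.analyticAt z
  have hev : ∀ᶠ z in 𝓝 (((|R| + 1 : ℝ)) : ℂ), φ z = 0 := by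
    have hopen : IsOpen {z : ℂ | R < ‖z‖} := isOpen_lt continuous_const continuous_norm
    refine mem_of_superset (hopen.mem_nhds ?_) fun z hz => hcon z hz
    rw [Set.mem_ofPred_eq, Complex.norm_real, Real.norm_of_nonneg (by positivity)]
    linarith [le_abs_self R]
  exact han.eqOn_zero_of_preconnected_of_eventuallyEq_zero isPreconnected_univ (Set.mem_univ _) hev
    (Set.mem_univ z₀)

theorem exists_differentiable_limit {E : Type*} [NormedAddCommGroup E] [NormedSpace ℂ E]
    [CompleteSpace E] {a : ℕ → ℂ → E} (ha : ∀ k, Differentiable ℂ (a k))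
    (hle : ∀ (k : ℕ) z, ‖z‖ ≤ k → ‖a (k + 1) z - a k z‖ ≤ (1 / 2) ^ k) :
    ∃ b : ℂ → E, Differentiable ℂ b ∧ ∀ z, Tendsto (fun k => a k z) atTop (𝓝 (b z)) := by
  have hstep : ∀ N : ℕ, ∀ z : ℂ, ‖z‖ ≤ N → ∀ k : ℕ,
      dist (a (k + N) z) (a (k + 1 + N) z) ≤ 2 / 2 / 2 ^ k := by
    intro N z hz k
    rw [dist_comm, dist_eq_norm, show k + 1 + N = k + N + 1 by ring]
    refine (hle (k + N) z (hz.trans (by simp))).trans ?_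
    rw [one_div, inv_pow, div_self two_ne_zero, one_div]
    gcongr
    · norm_num
    · omega
  have hlim : ∀ z : ℂ, ∃ b, Tendsto (fun k => a k z) atTop (𝓝 b) := by
    intro z
    obtain ⟨b, hb⟩ := cauchySeq_tendsto_of_complete
      (cauchySeq_of_le_geometric_two (hstep ⌈‖z‖⌉₊ z (Nat.le_ceil _)))
    exact ⟨b, (tendsto_add_atTop_iff_nat _).1 hb⟩
  choose b hb using hlim
  refine ⟨b, ?_, hb⟩
  rw [← differentiableOn_univ]
  refine TendstoLocallyUniformlyOn.differentiableOn (F := a) (φ := atTop) ?_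
    (Eventually.of_forall fun k => (ha k).differentiableOn) isOpen_univ
  rw [Metric.tendstoLocallyUniformlyOn_iff]
  intro η hη z _
  set N := ⌈‖z‖ + 1⌉₊
  refine ⟨Metric.ball z 1, mem_nhdsWithin_of_mem_nhds (Metric.ball_mem_nhds z one_pos), ?_⟩
  have hsmall : Tendsto (fun k : ℕ => (2 : ℝ) / 2 ^ k) atTop (𝓝 0) := by
    simpa [div_eq_mul_inv] using
      (tendsto_pow_atTop_nhds_zero_of_lt_one (r := (2 : ℝ)⁻¹) (by norm_num) (by norm_num)).const_mul 2
  obtain ⟨M, hM⟩ := eventually_atTop.1 (hsmall.eventually_lt_const hη)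
  filter_upwards [eventually_ge_atTop (M + N)] with k hk y hy
  have hyN : ‖y‖ ≤ N := by
    have h1 : ‖y - z‖ < 1 := by simpa [dist_eq_norm] using hy
    have h2 : ‖y‖ ≤ ‖y - z‖ + ‖z‖ := by simpa using norm_add_le (y - z) z
    linarith [Nat.le_ceil (‖z‖ + 1)]
  have := dist_le_of_le_geometric_two_of_tendsto (hstep N y hyN)
    ((tendsto_add_atTop_iff_nat N).2 (hb y)) (k - N)
  rw [Nat.sub_add_cancel (by omega), dist_comm] at this
  exact this.trans_lt (hM (k - N) (by omega))

end EntireCurves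

section Construction

variable {𝔸 : Type*} [NormedRing 𝔸] [NormedAlgebra ℂ 𝔸] [CompleteSpace 𝔸]
  {V : Type*} [AddCommGroup V] [Module ℂ V]

theorem exists_entire_modification_separating {G : Subgroup 𝔸ˣ} {E : ℂ → 𝔸ˣ → V →ₗ[ℂ] ℂ}
    (hE : ∀ h q, Differentiable ℂ fun z => E z h q) (W : Submodule ℂ V) [FiniteDimensional ℂ W]
    {g : ℂ → 𝔸ˣ} (hg : Differentiable ℂ fun z => (g z : 𝔸))
    (hgH : ∀ z, g z ∈ entireCurveSubgroup G) (F : Finset ℂ) {R : ℝ} (hR : 0 ≤ R) {ε : ℝ}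
    (hε : 0 < ε) :
    ∃ (g' : ℂ → 𝔸ˣ) (F' : Finset ℂ), Differentiable ℂ (fun z => (g' z : 𝔸)) ∧
      (∀ z, g' z ∈ entireCurveSubgroup G) ∧ F ⊆ F' ∧ (∀ z ∈ F, g' z = g z) ∧
      (∀ z, ‖z‖ ≤ R → ‖(g' z : 𝔸) - g z‖ < ε ∧ ‖((g' z)⁻¹.val : 𝔸) - (g z)⁻¹.val‖ < ε) ∧
      ∀ q ∈ W, (∀ z ∈ F', E z (g' z) q = 0) → ∀ z, ∀ h ∈ entireCurveSubgroup G, E z h q = 0 := by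
  classical
  set K : (ℂ → 𝔸ˣ) → Finset ℂ → Submodule ℂ V :=
    fun g F => W ⊓ ⨅ z ∈ F, LinearMap.ker (E z (g z)) with hK
  have mem_K : ∀ g F q, q ∈ K g F ↔ q ∈ W ∧ ∀ z ∈ F, E z (g z) q = 0 := by
    intro g F q
    simp [hK, Submodule.mem_iInf]
  induction hN : Module.finrank ℂ (K g F) using Nat.strong_induction_on generalizing g F ε with
  | _ N ih =>
    by_cases hall : ∀ q ∈ K g F, ∀ z, ∀ h ∈ entireCurveSubgroup G, E z h q = 0
    · exact ⟨g, F, hg, hgH, subset_rfl, fun _ _ => rfl, fun z _ => by simpa using hε,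
        fun q hq hqF => hall q ((mem_K g F q).2 ⟨hq, hqF⟩)⟩
    · push Not at hall
      obtain ⟨q, hq, z₀, h, hh, hne⟩ := hall
      obtain ⟨B, hB⟩ := F.finite_toSet.isBounded.exists_norm_le
      obtain ⟨w, hw, hwne⟩ := exists_ne_zero_of_large_norm (hE h q) hne (max R B)
      have hwF : w ∉ F := fun hmem => ((le_max_right R B).trans_lt hw).not_ge (hB w hmem)
      obtain ⟨g₁, hg₁, hg₁H, hg₁F, hg₁w, hg₁R⟩ := exists_entire_modification hg hgH F hwF hR
        ((le_max_left R B).trans_lt hw) (half_pos hε) hh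
      have hle : K g₁ (insert w F) ≤ K g F := by
        intro r hr
        rw [mem_K] at hr ⊢
        refine ⟨hr.1, fun z hz => ?_⟩
        rw [← hg₁F z hz]
        exact hr.2 z (Finset.mem_insert_of_mem hz)
      have hlt : K g₁ (insert w F) < K g F := by
        refine lt_of_le_not_ge hle fun hge => hwne ?_
        have := ((mem_K _ _ q).1 (hge hq)).2 w (Finset.mem_insert_self w F)
        rwa [hg₁w] at this
      have : FiniteDimensional ℂ (K g F) := Submodule.finiteDimensional_of_le inf_le_left
      obtain ⟨g₂, F₂, hg₂, hg₂H, hF₂, hg₂F, hg₂R, hsep⟩ := ih _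
        (hN ▸ Submodule.finrank_lt_finrank_of_lt hlt) hg₁ hg₁H (insert w F) (half_pos hε) rfl
      refine ⟨g₂, F₂, hg₂, hg₂H, (Finset.subset_insert w F).trans hF₂, fun z hz => ?_,
        fun z hz => ⟨?_, ?_⟩, hsep⟩
      · rw [hg₂F z (Finset.mem_insert_of_mem hz), hg₁F z hz]
      · have h1 := norm_add_le ((g₂ z : 𝔸) - g₁ z) (g₁ z - g z)
        rw [sub_add_sub_cancel] at h1
        linarith [(hg₂R z hz).1, (hg₁R z hz).1]
      · have h1 := norm_add_le (((g₂ z)⁻¹.val : 𝔸) - (g₁ z)⁻¹.val) ((g₁ z)⁻¹.val - (g z)⁻¹.val)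
        rw [sub_add_sub_cancel] at h1
        linarith [(hg₂R z hz).2, (hg₁R z hz).2]

/-- In a closed subgroup `G` there is an entire curve along which the only functions of a countably
filtered family that vanish are those vanishing at all points reachable by entire curves. -/
theorem exists_entire_curve_separating {G : Subgroup 𝔸ˣ} (hG : IsClosed (G : Set 𝔸ˣ))
    {E : ℂ → 𝔸ˣ → V →ₗ[ℂ] ℂ} (hE : ∀ h q, Differentiable ℂ fun z => E z h q)
    (W : ℕ → Submodule ℂ V) [∀ k, FiniteDimensional ℂ (W k)] :
    ∃ g : ℂ → 𝔸ˣ, Differentiable ℂ (fun z => (g z : 𝔸)) ∧ (∀ z, g z ∈ G) ∧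
      ∀ k, ∀ q ∈ W k, (∀ z, E z (g z) q = 0) →
        ∀ z, ∀ h ∈ entireCurveSubgroup G, E z h q = 0 := by
  let S := {s : (ℂ → 𝔸ˣ) × Finset ℂ // Differentiable ℂ (fun z => (s.1 z : 𝔸)) ∧
    ∀ z, s.1 z ∈ entireCurveSubgroup G}
  have hstep : ∀ (k : ℕ) (s : S), ∃ s' : S, s.1.2 ⊆ s'.1.2 ∧ (∀ z ∈ s.1.2, s'.1.1 z = s.1.1 z) ∧
      (∀ z, ‖z‖ ≤ k → ‖(s'.1.1 z : 𝔸) - s.1.1 z‖ < (1 / 2) ^ k ∧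
        ‖((s'.1.1 z)⁻¹.val : 𝔸) - (s.1.1 z)⁻¹.val‖ < (1 / 2) ^ k) ∧
      ∀ q ∈ W k, (∀ z ∈ s'.1.2, E z (s'.1.1 z) q = 0) →
        ∀ z, ∀ h ∈ entireCurveSubgroup G, E z h q = 0 := by
    rintro k ⟨⟨g, F⟩, hg, hgH⟩
    obtain ⟨g', F', hg', hg'H, h⟩ := exists_entire_modification_separating hE (W k) hg hgH F
      (Nat.cast_nonneg k) (ε := (1 / 2) ^ k) (by positivity)
    exact ⟨⟨(g', F'), hg', hg'H⟩, h⟩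
  choose next hsub heq hclose hsep using hstep
  let s : ℕ → S := fun k => Nat.rec ⟨(fun _ => 1, ∅), by simp, fun _ => one_mem _⟩ next k
  have hs : ∀ k, s (k + 1) = next k (s k) := fun _ => rfl
  obtain ⟨a, ha, hla⟩ := exists_differentiable_limit (a := fun k z => ((s k).1.1 z : 𝔸))
    (fun k => (s k).2.1) (fun k z hz => by rw [hs]; exact (hclose k (s k) z hz).1.le)
  obtain ⟨b, -, hlb⟩ := exists_differentiable_limit (a := fun k z => (((s k).1.1 z)⁻¹.val : 𝔸))
    (fun k => differentiable_units_inv (s k).2.1)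
    (fun k z hz => by rw [hs]; exact (hclose k (s k) z hz).2.le)
  have hab : ∀ z, a z * b z = 1 := fun z =>
    tendsto_nhds_unique ((hla z).mul (hlb z)) (by simp)
  have hba : ∀ z, b z * a z = 1 := fun z =>
    tendsto_nhds_unique ((hlb z).mul (hla z)) (by simp)
  let g : ℂ → 𝔸ˣ := fun z => ⟨a z, b z, hab z, hba z⟩
  have hlg : ∀ z, Tendsto (fun k => (s k).1.1 z) atTop (𝓝 (g z)) := fun z =>
    Units.isOpenEmbedding_val.isInducing.tendsto_nhds_iff.2 (hla z)
  have hF : ∀ k j, (s k).1.2 ⊆ (s (k + j)).1.2 ∧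
      ∀ z ∈ (s k).1.2, (s (k + j)).1.1 z = (s k).1.1 z := by
    intro k j
    induction j with
    | zero => exact ⟨subset_rfl, fun _ _ => rfl⟩
    | succ j ih =>
      rw [← add_assoc, hs]
      exact ⟨ih.1.trans (hsub _ _), fun z hz => (heq _ _ z (ih.1 hz)).trans (ih.2 z hz)⟩
  have hgF : ∀ k, ∀ z ∈ (s k).1.2, g z = (s k).1.1 z := by
    intro k z hz
    refine tendsto_nhds_unique (hlg z) (tendsto_const_nhds.congr' ?_)
    filter_upwards [eventually_ge_atTop k] with i hi
    obtain ⟨j, rfl⟩ := Nat.exists_eq_add_of_le hi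
    exact ((hF k j).2 z hz).symm
  refine ⟨g, ha, fun z => hG.mem_of_tendsto (hlg z)
    (Eventually.of_forall fun k => entireCurveSubgroup_le G ((s k).2.2 z)), fun k q hq hqz => ?_⟩
  refine hsep k (s k) q hq fun z hz => ?_
  have := hqz z
  rw [hgF (k + 1) z hz] at this
  exact this

end Construction

section ZariskiClosure

theorem differentiable_eval_mvPolynomial {σ : Type*} {x : ℂ → σ → ℂ}
    (hx : ∀ i, Differentiable ℂ fun z => x z i) (p : MvPolynomial σ ℂ) :
    Differentiable ℂ fun z => MvPolynomial.eval (x z) p := by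
  induction p using MvPolynomial.induction_on with
  | C a => simp
  | add p q hp hq => simpa using hp.fun_add hq
  | mul_X p i hp => simpa using hp.fun_mul (hx i)

theorem eq_zero_of_forall_ofReal {φ : ℂ → ℂ} (hφ : Differentiable ℂ φ)
    (h : ∀ t : ℝ, φ t = 0) (z : ℂ) : φ z = 0 := by
  have han : AnalyticOnNhd ℂ φ Set.univ := fun z _ => hφ.analyticAt z
  refine han.eqOn_zero_of_preconnected_of_frequently_eq_zero isPreconnected_univ (Set.mem_univ 0) ?_
    (Set.mem_univ z)
  have htend : Tendsto (fun t : ℝ => (t : ℂ)) (𝓝[≠] 0) (𝓝[≠] 0) := by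
    refine tendsto_nhdsWithin_iff.2 ⟨?_, ?_⟩
    · exact (Complex.continuous_ofReal.tendsto' 0 0 (by simp)).mono_left nhdsWithin_le_nhds
    · filter_upwards [self_mem_nhdsWithin] with t ht
      simpa using ht
  exact htend.frequently (Eventually.of_forall h).frequently

variable {𝔸 : Type*} [NormedRing 𝔸] [NormedAlgebra ℂ 𝔸] {ι : Type*} {c : ι → 𝔸 →L[ℂ] ℂ}

theorem continuous_eval_coordinates {σ : Type*} (x : σ → ℂ) (p : MvPolynomial (σ ⊕ ι) ℂ) :
    Continuous fun g : 𝔸ˣ => MvPolynomial.eval (Sum.elim x fun i => c i g) p := by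
  refine (MvPolynomial.continuous_eval p).comp (continuous_pi fun i => ?_)
  cases i with
  | inl i => exact continuous_const
  | inr i => exact (c i).continuous.comp Units.continuous_val

theorem isClosed_of_zeroLocus {G : Subgroup 𝔸ˣ} {P : Set (MvPolynomial ι ℂ)}
    (hGP : (G : Set 𝔸ˣ) = {g : 𝔸ˣ | ∀ p ∈ P, MvPolynomial.eval (fun i => c i g) p = 0}) :
    IsClosed (G : Set 𝔸ˣ) := by
  have : (G : Set 𝔸ˣ) = ⋂ p ∈ P, {g : 𝔸ˣ | MvPolynomial.eval (fun i => c i g) p = 0} := by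
    rw [hGP]; ext; simp
  rw [this]
  refine isClosed_biInter fun p _ => isClosed_eq ?_ continuous_const
  exact (MvPolynomial.continuous_eval p).comp
    (continuous_pi fun i => (c i).continuous.comp Units.continuous_val)

theorem expUnit_mem_entireCurveSubgroup [CompleteSpace 𝔸] {G : Subgroup 𝔸ˣ}
    {P : Set (MvPolynomial ι ℂ)}
    (hGP : (G : Set 𝔸ˣ) = {g : 𝔸ˣ | ∀ p ∈ P, MvPolynomial.eval (fun i => c i g) p = 0})
    {Y : 𝔸} (hY : ∀ t : ℝ, expUnit (t • Y) ∈ G) : expUnit Y ∈ entireCurveSubgroup G := by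
  have mem_G : ∀ g : 𝔸ˣ, g ∈ G ↔ ∀ p ∈ P, MvPolynomial.eval (fun i => c i g) p = 0 := fun g => by
    rw [← SetLike.mem_coe, hGP]; rfl
  have hd : Differentiable ℂ fun z : ℂ => (expUnit (z • Y) : 𝔸) := fun z =>
    (hasDerivAt_exp_smul_const (𝕂 := ℂ) Y z).differentiableAt
  refine ⟨fun z => expUnit (z • Y), hd, fun z => (mem_G _).2 fun p hp => ?_, ?_, ?_⟩
  · refine eq_zero_of_forall_ofReal
      (φ := fun z => MvPolynomial.eval (fun i => c i (expUnit (z • Y) : 𝔸ˣ)) p)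
      (differentiable_eval_mvPolynomial (fun i => (c i).differentiable.comp hd) p) (fun t => ?_) z
    have := (mem_G _).1 (hY t) p hp
    rwa [← Complex.coe_smul] at this
  · simp only [zero_smul, expUnit_zero]
  · simp only [one_smul]

/-- The points of a connected algebraic group that can be joined to the identity by an entire curve
in the group are dense. -/
theorem le_topologicalClosure_entireCurveSubgroup [ProperSpace 𝔸] {G : Subgroup 𝔸ˣ}
    {P : Set (MvPolynomial ι ℂ)}
    (hGP : (G : Set 𝔸ˣ) = {g : 𝔸ˣ | ∀ p ∈ P, MvPolynomial.eval (fun i => c i g) p = 0})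
    (hGconn : IsConnected (G : Set 𝔸ˣ)) :
    G ≤ (entireCurveSubgroup G).topologicalClosure := by
  have hG := isClosed_of_zeroLocus hGP
  refine le_of_one_parameter_subgroups hG hGconn (Subgroup.isClosed_topologicalClosure _)
    (Subgroup.topologicalClosure_minimal _ (entireCurveSubgroup_le G) hG) fun Y hY t => ?_
  refine Subgroup.le_topologicalClosure _ (expUnit_mem_entireCurveSubgroup hGP fun s => ?_)
  rw [smul_smul]
  exact hY _

theorem exists_entire_lift_of_coordinates [ProperSpace 𝔸] [Finite ι] {σ : Type*} [Finite σ]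
    {f : ℂ → σ → ℂ} (hf : ∀ i, Differentiable ℂ fun z => f z i) {G : Subgroup 𝔸ˣ}
    {P : Set (MvPolynomial ι ℂ)}
    (hGP : (G : Set 𝔸ˣ) = {g : 𝔸ˣ | ∀ p ∈ P, MvPolynomial.eval (fun i => c i g) p = 0})
    (hGconn : IsConnected (G : Set 𝔸ˣ)) :
    ∃ g : ℂ → 𝔸ˣ, (∀ i, Differentiable ℂ fun z => c i (g z)) ∧ (∀ z, g z ∈ G) ∧
      ∀ q : MvPolynomial (σ ⊕ ι) ℂ,
        (∀ z, MvPolynomial.eval (Sum.elim (f z) fun i => c i (g z)) q = 0) ↔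
        ∀ x : σ → ℂ,
          (∀ p : MvPolynomial σ ℂ, (∀ z, MvPolynomial.eval (f z) p = 0) →
            MvPolynomial.eval x p = 0) →
          ∀ h ∈ G, MvPolynomial.eval (Sum.elim x fun i => c i h) q = 0 := by
  let E : ℂ → 𝔸ˣ → MvPolynomial (σ ⊕ ι) ℂ →ₗ[ℂ] ℂ := fun z h =>
    (MvPolynomial.aeval (Sum.elim (f z) fun i => c i h)).toLinearMap
  have hE_apply : ∀ z h q, E z h q = MvPolynomial.eval (Sum.elim (f z) fun i => c i h) q :=
    fun z h q => by simp [E, MvPolynomial.aeval_eq_eval]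
  have hE : ∀ h q, Differentiable ℂ fun z => E z h q := by
    intro h q
    simp only [hE_apply]
    refine differentiable_eval_mvPolynomial (fun i => ?_) q
    cases i with
    | inl i => exact hf i
    | inr i => exact differentiable_const _
  obtain ⟨g, hg, hgG, hsep⟩ := exists_entire_curve_separating (isClosed_of_zeroLocus hGP) hE
    (MvPolynomial.restrictTotalDegree (σ ⊕ ι) ℂ)
  refine ⟨g, fun i => (c i).differentiable.comp hg, hgG, fun q => ⟨fun hq x hx h hh => ?_,
    fun hq z => hq (f z) (fun p hp => hp z) (g z) (hgG z)⟩⟩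
  have hH : ∀ z, ∀ h ∈ entireCurveSubgroup G, E z h q = 0 :=
    hsep q.totalDegree q ((MvPolynomial.mem_restrictTotalDegree _ _ _).2 le_rfl)
      fun z => (hE_apply _ _ _).trans (hq z)
  have hGz : ∀ z, MvPolynomial.eval (Sum.elim (f z) fun i => c i h) q = 0 := fun z =>
    closure_minimal (s := (entireCurveSubgroup G : Set 𝔸ˣ))
      (t := {h : 𝔸ˣ | MvPolynomial.eval (Sum.elim (f z) fun i => c i h) q = 0})
      (fun h hh => (hE_apply z h q).symm.trans (hH z h hh))
      (isClosed_eq (continuous_eval_coordinates (f z) q) continuous_const)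
      (le_topologicalClosure_entireCurveSubgroup hGP hGconn hh)
  let r : MvPolynomial σ ℂ := MvPolynomial.aeval
    (Sum.elim MvPolynomial.X fun i => MvPolynomial.C (c i h)) q
  have hr : ∀ y : σ → ℂ, MvPolynomial.eval y r =
      MvPolynomial.eval (Sum.elim y fun i => c i h) q := by
    intro y
    rw [← MvPolynomial.coe_aeval_eq_eval, ← MvPolynomial.coe_aeval_eq_eval, RingHom.coe_coe,
      RingHom.coe_coe, ← AlgHom.comp_apply]
    congr 1
    ext i
    cases i <;> simp
  rw [← hr]
  exact hx r fun z => (hr _).trans (hGz z)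

end ZariskiClosure

/-- the analytic lifting theorem of the paper, Theorem 2.5, for the
trivial principal bundle `X × G → X`. Let `f : ℂ → ℂⁿ` be an entire map and let
`G ⊆ GL_m(ℂ)` be a connected Zariski-closed subgroup (the zero locus in `GL_m(ℂ)` of
a set `P` of polynomials in the matrix entries). Then there is a holomorphic map
`g : ℂ → GL_m(ℂ)` with values in `G` such that the Zariski closure of
`{(f z, g z) : z ∈ ℂ}` in `ℂⁿ × ℂ^{m²}` is `X̄ × G`, where `X̄` is the Zariski
closure of `f(ℂ)`. -/
theorem exists_entire_lift_with_full_zariski_closure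
    (n m : ℕ) (f : ℂ → (Fin n → ℂ)) (hf : Differentiable ℂ f)
    (P : Set (MvPolynomial (Fin m × Fin m) ℂ))
    (G : Subgroup (GL (Fin m) ℂ))
    (hGP : (G : Set (GL (Fin m) ℂ)) =
      {g : GL (Fin m) ℂ | ∀ p ∈ P, MvPolynomial.eval
        (fun ij : Fin m × Fin m => (g : Matrix (Fin m) (Fin m) ℂ) ij.1 ij.2) p = 0})
    (hGconn : IsConnected (G : Set (GL (Fin m) ℂ))) :
    ∃ g : ℂ → GL (Fin m) ℂ,
      (∀ i j : Fin m,
        Differentiable ℂ (fun z => (g z : Matrix (Fin m) (Fin m) ℂ) i j)) ∧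
      (∀ z : ℂ, g z ∈ G) ∧
      ∀ q : MvPolynomial (Fin n ⊕ (Fin m × Fin m)) ℂ,
        (∀ z : ℂ, MvPolynomial.eval
            (Sum.elim (f z)
              (fun ij : Fin m × Fin m => (g z : Matrix (Fin m) (Fin m) ℂ) ij.1 ij.2))
            q = 0) ↔
        (∀ x : Fin n → ℂ,
          (∀ p : MvPolynomial (Fin n) ℂ,
            (∀ z : ℂ, MvPolynomial.eval (f z) p = 0) → MvPolynomial.eval x p = 0) →
          ∀ h ∈ G, MvPolynomial.eval
            (Sum.elim x
              (fun ij : Fin m × Fin m => (h : Matrix (Fin m) (Fin m) ℂ) ij.1 ij.2))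
            q = 0) := by
  open scoped Matrix.Norms.Operator in
  have : ProperSpace (Matrix (Fin m) (Fin m) ℂ) := FiniteDimensional.proper ℂ _
  have key := exists_entire_lift_of_coordinates (𝔸 := Matrix (Fin m) (Fin m) ℂ) (G := G) (P := P)
    (c := fun ij : Fin m × Fin m =>
      LinearMap.toContinuousLinearMap (Matrix.entryLinearMap ℂ ℂ ij.1 ij.2))
    (f := f) (differentiable_pi.1 hf) hGP hGconn
  obtain ⟨g, hg, hgG, hq⟩ := key
  exact ⟨g, fun i j => hg (i, j), hgG, hq⟩
end
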